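/- arXiv:2601.15107 — 7 statements merged into one kernel-verified Lean document; each statement's English description precedes it below -/
import Mathlib

section
/- Suppose ∫₀¹ f(t) dt ≥ 0 and, for some c ∈ ℝ, the boundary value problem on [0,1] admits a positive solution y (i.e., y is a Carathéodory solution on [0,1] with y(0) = y(1) = 0 and y(t) > 0 for all t ∈ (0,1)). Then c ≥ inf_{t ∈ [0,1]} h(t). Moreover, if ∫₀¹ f(t) dt > 0 then c > inf_{t ∈ [0,1]} h(t), while if ∫₀¹ f(t) dt = 0 then inf_{t ∈ [0,1]} h(t) ≤ c ≤ sup_{t ∈ [0,1]} h(t). -/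
open MeasureTheory Set Filter Topology intervalIntegral

noncomputable section

/-- A Carathéodory solution on `[a,b]` of the ODE
`y'(t) = p' * ((c - h t) * (y⁺ t)^(1/p) - f t)`, in integral form. -/
def IsCaraSol (p p' : ℝ) (h f : ℝ → ℝ) (c a b : ℝ) (y : ℝ → ℝ) : Prop :=
  ContinuousOn y (Set.Icc a b) ∧
  ∀ t ∈ Set.Icc a b,
    y t = y a + ∫ u in a..t, p' * ((c - h u) * (max (y u) 0) ^ (1 / p) - f u)

/-- A positive solution of the boundary value problem on `[a,b]`. -/
def IsPosBVPSol (p p' : ℝ) (h f : ℝ → ℝ) (c a b : ℝ) (y : ℝ → ℝ) : Prop :=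
  IsCaraSol p p' h f c a b y ∧ y a = 0 ∧ y b = 0 ∧ ∀ t ∈ Set.Ioo a b, 0 < y t
/-- Evaluating the integral equation at `b` for a solution vanishing at both ends. -/
theorem IsPosBVPSol.integral_eq {p p' c a b : ℝ} {h f y : ℝ → ℝ} (hp' : p' ≠ 0) (hab : a ≤ b)
    (hg : IntervalIntegrable (fun u => (c - h u) * (max (y u) 0) ^ (1 / p)) volume a b)
    (hf : IntervalIntegrable f volume a b) (hy : IsPosBVPSol p p' h f c a b y) :
    ∫ u in a..b, (c - h u) * (max (y u) 0) ^ (1 / p) = ∫ u in a..b, f u := by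
  obtain ⟨⟨-, hsol⟩, hya, hyb, -⟩ := hy
  have hb := hsol b (right_mem_Icc.2 hab)
  rw [hya, hyb, intervalIntegral.integral_const_mul, intervalIntegral.integral_sub hg hf,
    zero_add, eq_comm, mul_eq_zero] at hb
  exact sub_eq_zero.1 (hb.resolve_left hp')

/-- The convective term of the equation is integrable along a continuous function. -/
theorem intervalIntegrable_sub_mul_rpow {p c a b M : ℝ} {h y : ℝ → ℝ} (hp : 0 ≤ p) (hab : a ≤ b)
    (hmeas : Measurable h) (hM : ∀ t ∈ Icc a b, |h t| ≤ M) (hy : ContinuousOn y (Icc a b)) :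
    IntervalIntegrable (fun u => (c - h u) * (max (y u) 0) ^ (1 / p)) volume a b := by
  have hh : IntervalIntegrable (fun u => c - h u) volume a b := by
    refine intervalIntegrable_const.sub ?_
    rw [intervalIntegrable_iff_integrableOn_Icc_of_le hab]
    refine Measure.integrableOn_of_bounded (M := M) (by simp) hmeas.aestronglyMeasurable ?_
    exact (ae_restrict_mem measurableSet_Icc).mono fun t ht => by simpa using hM t ht
  refine hh.mul_continuousOn ?_
  rw [uIcc_of_le hab]
  exact (ContinuousOn.sup hy continuousOn_const).rpow_const fun _ _ => Or.inr (by positivity)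

theorem stmt_0
    (p p' s : ℝ) (h f : ℝ → ℝ)
    (hp : 1 < p) (hp'def : p' = p / (p - 1))
    (hs : s ∈ Set.Ioo (0:ℝ) 1)
    (hmeas : Measurable h)
    (hbd : ∃ M : ℝ, ∀ t ∈ Set.Icc (0:ℝ) 1, |h t| ≤ M)
    (hfint : MeasureTheory.IntegrableOn f (Set.Ioo (0:ℝ) 1))
    (hf0 : f 0 = 0) (hfs : f s = 0) (hf1 : f 1 = 0)
    (hfneg : ∀ t ∈ Set.Ioo (0:ℝ) s, f t < 0)
    (hfpos : ∀ t ∈ Set.Ioo s (1:ℝ), 0 < f t)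
    (husc : UpperSemicontinuousOn f (Set.Ioo (0:ℝ) s))
    (hlsc : LowerSemicontinuousOn f (Set.Ioo s (1:ℝ)))
    (c : ℝ)
    (hint : 0 ≤ ∫ t in (0:ℝ)..1, f t)
    (hsol : ∃ y, IsPosBVPSol p p' h f c 0 1 y) :
    sInf (h '' Set.Icc (0:ℝ) 1) ≤ c ∧
    ((0 < ∫ t in (0:ℝ)..1, f t) → sInf (h '' Set.Icc (0:ℝ) 1) < c) ∧
    ((∫ t in (0:ℝ)..1, f t) = 0 →
      sInf (h '' Set.Icc (0:ℝ) 1) ≤ c ∧ c ≤ sSup (h '' Set.Icc (0:ℝ) 1)) := by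
  obtain ⟨y, hy⟩ := hsol
  obtain ⟨M, hM⟩ := hbd
  have hp' : p' ≠ 0 := by
    rw [hp'def]
    exact (div_pos (by linarith) (by linarith)).ne'
  have hg : IntervalIntegrable (fun u => (c - h u) * (max (y u) 0) ^ (1 / p)) volume 0 1 :=
    intervalIntegrable_sub_mul_rpow (by linarith) zero_le_one hmeas hM hy.1.1
  have hf : IntervalIntegrable f volume 0 1 := by
    rwa [intervalIntegrable_iff_integrableOn_Ioo_of_le zero_le_one]
  have key := hy.integral_eq hp' zero_le_one hg hf
  have hw : ∀ t ∈ Ioo (0:ℝ) 1, 0 < (max (y t) 0) ^ (1 / p) := fun t ht =>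
    Real.rpow_pos_of_pos (lt_max_of_lt_left (hy.2.2.2 t ht)) _
  have hInf : ∀ t ∈ Ioo (0:ℝ) 1, sInf (h '' Icc (0:ℝ) 1) ≤ h t := fun t ht =>
    csInf_le ⟨-M, by rintro _ ⟨u, hu, rfl⟩; exact (abs_le.1 (hM u hu)).1⟩
      (mem_image_of_mem h (Ioo_subset_Icc_self ht))
  have hSup : ∀ t ∈ Ioo (0:ℝ) 1, h t ≤ sSup (h '' Icc (0:ℝ) 1) := fun t ht =>
    le_csSup ⟨M, by rintro _ ⟨u, hu, rfl⟩; exact (abs_le.1 (hM u hu)).2⟩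
      (mem_image_of_mem h (Ioo_subset_Icc_self ht))
  have hlow : sInf (h '' Icc (0:ℝ) 1) ≤ c := by
    by_contra! hc
    have hpos := intervalIntegral_pos_of_pos_on hg.neg
      (fun t ht => by
        have := mul_pos (sub_pos.2 (hc.trans_le (hInf t ht))) (hw t ht)
        simp only [Pi.neg_apply]
        linarith) zero_lt_one
    simp only [Pi.neg_apply, intervalIntegral.integral_neg, key] at hpos
    linarith
  refine ⟨hlow, fun hint_pos => ?_, fun hint_zero => ⟨hlow, ?_⟩⟩
  · by_contra! hc
    have hnonpos : ∫ u in (0:ℝ)..1, (c - h u) * (max (y u) 0) ^ (1 / p) ≤ ∫ _ in (0:ℝ)..1, (0:ℝ) :=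
      intervalIntegral.integral_mono_on_of_le_Ioo zero_le_one hg intervalIntegrable_const
        fun t ht => mul_nonpos_of_nonpos_of_nonneg
          (sub_nonpos.2 (hc.trans (hInf t ht))) (hw t ht).le
    rw [key, intervalIntegral.integral_zero] at hnonpos
    linarith
  · by_contra! hc
    have hpos := intervalIntegral_pos_of_pos_on hg
      (fun t ht => mul_pos (sub_pos.2 ((hSup t ht).trans_lt hc)) (hw t ht)) zero_lt_one
    linarith
end
end

section
/- For every c ∈ ℝ there exists at least one Carathéodory solution ỹ on [0,1] of the ODE with initial condition ỹ(0) = 0, and there exists at least one Carathéodory solution ŷ on [0,1] of the ODE with terminal condition ŷ(1) = 0. -/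
open MeasureTheory Set Filter Topology intervalIntegral

noncomputable section

/-- Tonelli's delayed equation: by the method of steps it has a solution up to time `1`. -/
theorem exists_delayed_solution {a b φ : ℝ → ℝ} {B δ : ℝ} (ha : Integrable a) (hb : Integrable b)
    (ha0 : ∀ u ≤ 0, a u = 0) (hb0 : ∀ u ≤ 0, b u = 0) (hφ : Continuous φ)
    (hB : ∀ r, |φ r| ≤ B) (hδ : 0 < δ) :
    ∃ Y : ℝ → ℝ, Continuous Y ∧
      ∀ t ≤ 1, Y t = ∫ u in (0 : ℝ)..t, (a u * φ (Y (u - δ)) + b u) := by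
  let T : (ℝ → ℝ) → ℝ → ℝ := fun y t => ∫ u in (0 : ℝ)..t, (a u * φ (y (u - δ)) + b u)
  have hT : ∀ y, Continuous y → Continuous (T y) := by
    intro y hy
    have hint : Integrable fun u => a u * φ (y (u - δ)) + b u :=
      (ha.mul_bdd (c := B) (by fun_prop) (ae_of_all _ fun u => hB _)).add hb
    exact intervalIntegral.continuous_primitive (fun _ _ => hint.intervalIntegrable) 0
  have hcont : ∀ n : ℕ, Continuous (T^[n] 0) := by
    intro n
    induction n with
    | zero => exact continuous_zero
    | succ k ih => rw [Function.iterate_succ_apply']; exact hT _ ih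
  have hstep : ∀ n : ℕ, ∀ t ≤ n * δ, T^[n + 1] 0 t = T^[n] 0 t := by
    intro n
    induction n with
    | zero =>
      intro t ht
      have ht0 : t ≤ 0 := by simpa using ht
      change (∫ u in (0 : ℝ)..t, (a u * φ _ + b u)) = 0
      rw [intervalIntegral.integral_congr (g := fun _ => (0 : ℝ))]
      · simp
      · intro u hu
        rw [uIcc_of_ge ht0] at hu
        simp [ha0 u hu.2, hb0 u hu.2]
    | succ k ih =>
      intro t ht
      rw [Function.iterate_succ_apply' T (k + 1), Function.iterate_succ_apply' T k]
      refine intervalIntegral.integral_congr fun u hu => ?_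
      have hu' : u ≤ max 0 t := hu.2
      have hk : (0 : ℝ) ≤ k * δ := by positivity
      push_cast at ht
      have : u - δ ≤ k * δ := by
        rcases max_cases 0 t with h | h <;> linarith [h.1]
      simp only [← Function.iterate_succ_apply' T k, ih _ this]
  obtain ⟨n, hn⟩ := exists_nat_ge (1 / δ)
  refine ⟨T^[n] 0, hcont n, fun t ht => ?_⟩
  rw [← hstep n t (ht.trans ((div_le_iff₀ hδ).1 hn)), Function.iterate_succ_apply']

/-- Carathéodory's existence theorem on `[0, 1]` for `y' = a φ(y) + b` with `φ` bounded. -/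
theorem exists_solution_of_bounded {a b φ : ℝ → ℝ} {B : ℝ} (ha : Integrable a) (hb : Integrable b)
    (ha0 : ∀ u ≤ 0, a u = 0) (hb0 : ∀ u ≤ 0, b u = 0) (hφ : Continuous φ)
    (hB : ∀ r, |φ r| ≤ B) :
    ∃ Y : ℝ → ℝ, ContinuousOn Y (Icc 0 1) ∧
      ∀ t ∈ Icc (0 : ℝ) 1, Y t = ∫ u in (0 : ℝ)..t, (a u * φ (Y u) + b u) := by
  let δ : ℕ → ℝ := fun n => 1 / ((n : ℝ) + 1)
  have hδ : ∀ n, 0 < δ n := fun n => by positivity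
  have hδ0 : Tendsto δ atTop (𝓝 0) := tendsto_one_div_add_atTop_nhds_zero_nat
  choose Y hYc hY using fun n => exists_delayed_solution ha hb ha0 hb0 hφ hB (hδ n)
  let m : ℝ → ℝ := fun u => |a u| * B + |b u|
  have hm : Integrable m := (ha.abs.mul_const B).add hb.abs
  have hbound : ∀ u r, ‖a u * φ r + b u‖ ≤ m u := fun u r => by
    refine (norm_add_le _ _).trans ?_
    simp only [norm_mul, Real.norm_eq_abs, m]
    gcongr
    exact hB r
  have hFint : ∀ n, Integrable fun u => a u * φ (Y n (u - δ n)) + b u := fun n =>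
    (ha.mul_bdd (c := B) ((hφ.comp ((hYc n).comp (continuous_sub_right _))).aestronglyMeasurable)
      (ae_of_all _ fun u => hB _)).add hb
  let W : ℝ → ℝ := fun t => ∫ u in (0 : ℝ)..t, m u
  have hW : Continuous W :=
    intervalIntegral.continuous_primitive (fun _ _ => hm.intervalIntegrable) 0
  have hmod : ∀ n, ∀ s ≤ 1, ∀ t ≤ 1, |Y n s - Y n t| ≤ |W s - W t| := by
    intro n s hs t ht
    rw [hY n s hs, hY n t ht,
      intervalIntegral.integral_interval_sub_left (hFint n).intervalIntegrable
        (hFint n).intervalIntegrable,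
      intervalIntegral.integral_interval_sub_left hm.intervalIntegrable hm.intervalIntegrable]
    exact intervalIntegral.norm_integral_le_abs_of_norm_le
      (ae_of_all _ fun u => hbound u _) hm.intervalIntegrable
  have hY0 : ∀ n, Y n 0 = 0 := fun n => by rw [hY n 0 zero_le_one]; simp
  let Z : ℕ → BoundedContinuousFunction (Icc (0 : ℝ) 1) ℝ := fun n =>
    BoundedContinuousFunction.mkOfCompact ⟨fun x => Y n x, (hYc n).comp continuous_subtype_val⟩
  have hZ : ∀ n x, Z n x = Y n x := fun _ _ => rfl
  have hcomp : IsCompact (closure (range Z)) := by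
    obtain ⟨C, hC⟩ := isCompact_Icc.exists_bound_of_continuousOn (s := Icc (0 : ℝ) 1) hW.continuousOn
    refine BoundedContinuousFunction.arzela_ascoli (Icc (-C) C) isCompact_Icc _ ?_ ?_
    · rintro _ x ⟨n, rfl⟩
      have h1 := hmod n x x.2.2 0 zero_le_one
      have h2 := hC x x.2
      have h3 : W 0 = 0 := intervalIntegral.integral_same
      rw [hY0, h3, sub_zero, sub_zero] at h1
      exact abs_le.1 (h1.trans h2)
    · intro x₀
      refine Metric.equicontinuousAt_of_continuity_modulus (fun x : Icc (0 : ℝ) 1 => |W x₀ - W x|) ?_ _ ?_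
      · have : Continuous fun x : Icc (0 : ℝ) 1 => |W x₀ - W x| := by fun_prop
        simpa using this.tendsto x₀
      · refine Eventually.of_forall fun x => ?_
        rintro ⟨_, n, rfl⟩
        exact hmod n x₀ x₀.2.2 x x.2.2
  obtain ⟨y, -, ψ, hψ, hlim⟩ := hcomp.tendsto_subseq fun n => subset_closure (mem_range_self n)
  have hpt : ∀ x : Icc (0 : ℝ) 1, Tendsto (fun n => Y (ψ n) x) atTop (𝓝 (y x)) := fun x =>
    ((continuous_eval_const x).tendsto y).comp hlim
  have hext : ∀ t (ht : t ∈ Icc (0 : ℝ) 1), IccExtend zero_le_one y t = y ⟨t, ht⟩ :=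
    fun t ht => IccExtend_of_mem _ _ ht
  refine ⟨IccExtend zero_le_one y, y.continuous.Icc_extend'.continuousOn, fun t ht => ?_⟩
  have hδψ : Tendsto (fun n => δ (ψ n)) atTop (𝓝 0) := hδ0.comp hψ.tendsto_atTop
  rw [hext t ht]
  refine tendsto_nhds_unique (hpt ⟨t, ht⟩) ?_
  simp only [fun n => hY (ψ n) t ht.2]
  refine intervalIntegral.tendsto_integral_filter_of_dominated_convergence m
    (Eventually.of_forall fun n => (hFint _).aestronglyMeasurable.restrict)
    (Eventually.of_forall fun n => ae_of_all _ fun u _ => hbound u _)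
    hm.intervalIntegrable (ae_of_all _ fun u hu => ?_)
  rw [uIoc_of_le ht.1] at hu
  have hu1 : u ∈ Icc (0 : ℝ) 1 := ⟨hu.1.le, hu.2.trans ht.2⟩
  rw [hext u hu1]
  refine ((hφ.tendsto _).comp ?_).const_mul _ |>.add_const _
  have hdiff : Tendsto (fun n => Y (ψ n) (u - δ (ψ n)) - Y (ψ n) u) atTop (𝓝 0) := by
    refine squeeze_zero_norm (a := fun n => |W (u - δ (ψ n)) - W u|) (fun n =>
      hmod _ _ (by linarith [hδ (ψ n), hu1.2]) u hu1.2) ?_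
    have h1 : Tendsto (fun n => u - δ (ψ n)) atTop (𝓝 u) := by
      simpa using hδψ.const_sub u
    simpa using (((hW.tendsto u).comp h1).sub_const (W u)).abs
  simpa using hdiff.add (hpt ⟨u, hu1⟩)

/-- Existence on `[0, 1]` for `y' = a (y⁺)^q + b` with sublinear exponent `q`. -/
theorem exists_solution_rpow_posPart {a b : ℝ → ℝ} {q : ℝ} (hq : 0 < q) (hq1 : q < 1)
    (ha : IntegrableOn a (Ioc 0 1)) (hb : IntegrableOn b (Ioc 0 1)) :
    ∃ Y : ℝ → ℝ, ContinuousOn Y (Icc 0 1) ∧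
      ∀ t ∈ Icc (0 : ℝ) 1, Y t = ∫ u in (0 : ℝ)..t, (a u * (max (Y u) 0) ^ q + b u) := by
  let α := (Ioc (0 : ℝ) 1).indicator a
  let β := (Ioc (0 : ℝ) 1).indicator b
  have hα : Integrable α := ha.integrable_indicator measurableSet_Ioc
  have hβ : Integrable β := hb.integrable_indicator measurableSet_Ioc
  let A := ∫ u, |α u|
  let B := ∫ u, |β u|
  have hA : 0 ≤ A := integral_nonneg fun _ => abs_nonneg _
  have hB : 0 ≤ B := integral_nonneg fun _ => abs_nonneg _
  obtain ⟨R, hR0, hR⟩ : ∃ R : ℝ, 0 ≤ R ∧ A * R ^ q + B ≤ R := by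
    have h1 : (1 : ℝ) ≤ 1 + A + B := by linarith
    refine ⟨(1 + A + B) ^ (1 / (1 - q)), by positivity, ?_⟩
    set R := (1 + A + B) ^ (1 / (1 - q)) with hRdef
    have hRpos : 0 < R := by positivity
    have hR1 : 1 ≤ R := Real.one_le_rpow h1 (by rw [one_div_nonneg]; linarith)
    have h2 : R ^ (1 - q) = 1 + A + B := by
      rw [hRdef, ← Real.rpow_mul (by positivity), one_div_mul_cancel (by linarith), Real.rpow_one]
    have h3 : R = R ^ q * (1 + A + B) := by
      rw [← h2, ← Real.rpow_add hRpos]; simp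
    have h4 : 1 ≤ R ^ q := Real.one_le_rpow hR1 hq.le
    nlinarith
  let φ : ℝ → ℝ := fun r => (max (min r R) 0) ^ q
  have hφc : Continuous φ :=
    ((continuous_id.min continuous_const).max continuous_const).rpow_const fun _ => Or.inr hq.le
  have hφ : ∀ r, |φ r| ≤ R ^ q := fun r => by
    rw [abs_of_nonneg (by positivity)]
    exact Real.rpow_le_rpow (le_max_right _ _) (max_le (min_le_right _ _) hR0) hq.le
  obtain ⟨Y, hYc, hY⟩ := exists_solution_of_bounded hα hβ
    (fun u hu => indicator_of_notMem (fun h => hu.not_gt h.1) _)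
    (fun u hu => indicator_of_notMem (fun h => hu.not_gt h.1) _) hφc hφ
  have hYR : ∀ t ∈ Icc (0 : ℝ) 1, Y t ≤ R := by
    intro t ht
    have hm : Integrable fun u => |α u| * R ^ q + |β u| := (hα.abs.mul_const _).add hβ.abs
    calc Y t ≤ ‖∫ u in (0 : ℝ)..t, (α u * φ (Y u) + β u)‖ := by rw [← hY t ht]; exact le_abs_self _
      _ ≤ ∫ u in (0 : ℝ)..t, (|α u| * R ^ q + |β u|) := by
        refine intervalIntegral.norm_integral_le_of_norm_le ht.1 (ae_of_all _ fun u _ => ?_)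
          hm.intervalIntegrable
        refine (norm_add_le _ _).trans ?_
        simp only [norm_mul, Real.norm_eq_abs]
        gcongr
        exact hφ _
      _ ≤ ∫ u, (|α u| * R ^ q + |β u|) := by
        rw [intervalIntegral.integral_of_le ht.1]
        exact setIntegral_le_integral hm (ae_of_all _ fun u => by positivity)
      _ = A * R ^ q + B := by
        rw [integral_add (hα.abs.mul_const _) hβ.abs, MeasureTheory.integral_mul_const]
      _ ≤ R := hR
  refine ⟨Y, hYc, fun t ht => ?_⟩
  rw [hY t ht, intervalIntegral.integral_of_le ht.1, intervalIntegral.integral_of_le ht.1]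
  refine setIntegral_congr_fun measurableSet_Ioc fun u hu => ?_
  have hu1 : u ∈ Ioc (0 : ℝ) 1 := ⟨hu.1, hu.2.trans ht.2⟩
  simp only [α, β, φ, indicator_of_mem hu1, min_eq_left (hYR u ⟨hu1.1.le, hu1.2⟩)]

theorem stmt_1
    (p p' s : ℝ) (h f : ℝ → ℝ)
    (hp : 1 < p) (hp'def : p' = p / (p - 1))
    (hs : s ∈ Set.Ioo (0:ℝ) 1)
    (hmeas : Measurable h)
    (hbd : ∃ M : ℝ, ∀ t ∈ Set.Icc (0:ℝ) 1, |h t| ≤ M)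
    (hfint : MeasureTheory.IntegrableOn f (Set.Ioo (0:ℝ) 1))
    (hf0 : f 0 = 0) (hfs : f s = 0) (hf1 : f 1 = 0)
    (hfneg : ∀ t ∈ Set.Ioo (0:ℝ) s, f t < 0)
    (hfpos : ∀ t ∈ Set.Ioo s (1:ℝ), 0 < f t)
    (husc : UpperSemicontinuousOn f (Set.Ioo (0:ℝ) s))
    (hlsc : LowerSemicontinuousOn f (Set.Ioo s (1:ℝ)))
    (c : ℝ) :
    (∃ y, IsCaraSol p p' h f c 0 1 y ∧ y 0 = 0) ∧
    (∃ y, IsCaraSol p p' h f c 0 1 y ∧ y 1 = 0) := by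
  obtain ⟨M, hM⟩ := hbd
  have hq : 0 < 1 / p := by positivity
  have hq1 : 1 / p < 1 := (div_lt_one (by linarith)).2 hp
  have ha : IntegrableOn (fun u => p' * (c - h u)) (Ioc 0 1) := by
    refine Integrable.const_mul (Integrable.sub (integrable_const c) ?_) p'
    exact Measure.integrableOn_of_bounded (M := M) (by simp) hmeas.aestronglyMeasurable
      ((ae_restrict_iff' measurableSet_Ioc).2 (ae_of_all _ fun u hu => hM u ⟨hu.1.le, hu.2⟩))
  have hb : IntegrableOn (fun u => -(p' * f u)) (Ioc 0 1) :=
    (((integrableOn_Ioc_iff_integrableOn_Ioo).2 hfint).const_mul p').neg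
  have hrefl : ∀ {g : ℝ → ℝ}, IntegrableOn g (Ioc 0 1) →
      IntegrableOn (fun u => -g (1 - u)) (Ioc 0 1) := by
    intro g hg
    rw [← intervalIntegrable_iff_integrableOn_Ioc_of_le zero_le_one] at hg ⊢
    simpa [Pi.neg_def] using (hg.comp_sub_left 1).symm.neg
  refine ⟨?_, ?_⟩
  · obtain ⟨Y, hYc, hY⟩ := exists_solution_rpow_posPart hq hq1 ha hb
    have hY0 : Y 0 = 0 := by simpa using hY 0 (by simp)
    refine ⟨Y, ⟨hYc, fun t ht => ?_⟩, hY0⟩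
    rw [hY0, zero_add, hY t ht]
    exact intervalIntegral.integral_congr fun u _ => by ring
  · obtain ⟨Z, hZc, hZ⟩ := exists_solution_rpow_posPart hq hq1 (hrefl ha) (hrefl hb)
    have hZ0 : Z 0 = 0 := by simpa using hZ 0 (by simp)
    have hmem : ∀ t ∈ Icc (0 : ℝ) 1, 1 - t ∈ Icc (0 : ℝ) 1 := fun t ht =>
      ⟨by linarith [ht.2], by linarith [ht.1]⟩
    let G : ℝ → ℝ := fun u => p' * ((c - h u) * (max (Z (1 - u)) 0) ^ (1 / p) - f u)
    have hYc : ContinuousOn (fun t => Z (1 - t)) (Icc 0 1) :=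
      hZc.comp (by fun_prop) hmem
    have hG : IntervalIntegrable G volume 0 1 := by
      have h1 : ContinuousOn (fun u => (max (Z (1 - u)) 0) ^ (1 / p)) (uIcc 0 1) := by
        rw [uIcc_of_le zero_le_one]
        exact (hYc.sup continuousOn_const).rpow_const fun _ _ => Or.inr hq.le
      rw [← intervalIntegrable_iff_integrableOn_Ioc_of_le zero_le_one] at ha hb
      refine ((ha.mul_continuousOn h1).add hb).congr fun u _ => ?_
      simp only [G]
      ring
    have hYG : ∀ t ∈ Icc (0 : ℝ) 1, Z (1 - t) = -∫ u in t..1, G u := by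
      intro t ht
      rw [hZ _ (hmem t ht), ← intervalIntegral.integral_neg]
      have := intervalIntegral.integral_comp_sub_left (a := 0) (b := 1 - t) (fun u => -G u) 1
      rw [sub_sub_cancel, sub_zero] at this
      rw [← this]
      refine intervalIntegral.integral_congr fun u _ => ?_
      simp only [G, sub_sub_cancel]
      ring
    refine ⟨fun t => Z (1 - t), ⟨hYc, fun t ht => ?_⟩, by simp [hZ0]⟩
    change Z (1 - t) = Z (1 - 0) + ∫ u in (0 : ℝ)..t, G u
    rw [hYG t ht, hYG 0 (by simp)]
    have h01 : t ∈ uIcc (0 : ℝ) 1 := by rwa [uIcc_of_le zero_le_one]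
    rw [← intervalIntegral.integral_add_adjacent_intervals
      (hG.mono_set (uIcc_subset_uIcc left_mem_uIcc h01))
      (hG.mono_set (uIcc_subset_uIcc h01 right_mem_uIcc))]
    ring
end
end

section
/- Fix c ∈ ℝ. Every Carathéodory solution ỹ on [0,1] of the ODE with ỹ(0) = 0 satisfies ỹ(t) > 0 for all t ∈ (0, s_*), and every Carathéodory solution ŷ on [0,1] of the ODE with ŷ(1) = 0 satisfies ŷ(t) > 0 for all t ∈ (s_*, 1). -/
open MeasureTheory Set Filter Topology intervalIntegral

noncomputable section

/-- If `y` is a primitive of `F` on `[a, b]` with `0 ≤ y a` and `F` is positive near every interior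
point at which `y ≤ 0`, then `y` is positive on `(a, b)`. -/
theorem pos_of_integral_of_eventually_pos {a b : ℝ} {F y : ℝ → ℝ}
    (hy : ContinuousOn y (Icc a b)) (hF : IntegrableOn F (Icc a b))
    (hint : ∀ u ∈ Icc a b, ∀ v ∈ Icc a b, y v - y u = ∫ x in u..v, F x) (ha : 0 ≤ y a)
    (hpos : ∀ t ∈ Ioo a b, y t ≤ 0 → ∀ᶠ u in 𝓝 t, 0 < F u) :
    ∀ t ∈ Ioo a b, 0 < y t := by
  have lt_of_pos : ∀ u ∈ Icc a b, ∀ v ∈ Icc a b, u < v → (∀ x ∈ Ioo u v, 0 < F x) →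
      y u < y v := by
    intro u hu v hv huv hFx
    have hi : IntervalIntegrable F volume u v := by
      rw [intervalIntegrable_iff_integrableOn_Icc_of_le huv.le]
      exact hF.mono_set (Icc_subset_Icc hu.1 hv.2)
    have h0 := intervalIntegral_pos_of_pos_on hi hFx huv
    have h1 := hint u hu v hv
    linarith
  have nonneg : ∀ t ∈ Ioo a b, 0 ≤ y t := by
    intro t ht
    by_contra! hneg
    have hclosed : IsClosed (Icc a t ∩ y ⁻¹' Ici 0) :=
      (hy.mono (Icc_subset_Icc_right ht.2.le)).preimage_isClosed_of_isClosed isClosed_Icc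
        isClosed_Ici
    have hcomp : IsCompact (Icc a t ∩ y ⁻¹' Ici 0) :=
      isCompact_Icc.of_isClosed_subset hclosed inter_subset_left
    obtain ⟨r, ⟨hr, hyr⟩, hub⟩ := hcomp.exists_isGreatest ⟨a, ⟨le_rfl, ht.1.le⟩, ha⟩
    have hyr' : 0 ≤ y r := hyr
    have hrt : r < t := lt_of_le_of_ne hr.2 (by rintro rfl; linarith)
    have hlt := lt_of_pos r ⟨hr.1, hr.2.trans ht.2.le⟩ t (Ioo_subset_Icc_self ht) hrt (by
      intro x hx
      refine (hpos x ⟨hr.1.trans_lt hx.1, hx.2.trans ht.2⟩ ?_).self_of_nhds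
      by_contra! hxy
      exact absurd (hub ⟨⟨hr.1.trans hx.1.le, hx.2.le⟩, hxy.le⟩) (not_le.mpr hx.1))
    linarith
  intro t ht
  by_contra! hle
  obtain ⟨l, hlt, hl⟩ := exists_Ioc_subset_of_mem_nhds
    (Filter.inter_mem (hpos t ht hle) (isOpen_Ioo.mem_nhds ht)) ⟨a, ht.1⟩
  replace hlt : l < t := hlt
  have hm : (l + t) / 2 ∈ Ioc l t := ⟨by linarith, by linarith⟩
  have hmt : (l + t) / 2 < t := by linarith
  have hmab := (hl hm).2
  have := lt_of_pos _ (Ioo_subset_Icc_self hmab) t (Ioo_subset_Icc_self ht) hmt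
    fun x hx => (hl ⟨hm.1.trans hx.1, hx.2.le⟩).1
  linarith [nonneg _ hmab]

/-- Time-reversed form of `pos_of_integral_of_eventually_pos`. -/
theorem pos_of_integral_of_eventually_neg {a b : ℝ} {F y : ℝ → ℝ}
    (hy : ContinuousOn y (Icc a b)) (hF : IntegrableOn F (Icc a b))
    (hint : ∀ u ∈ Icc a b, ∀ v ∈ Icc a b, y v - y u = ∫ x in u..v, F x) (hb : 0 ≤ y b)
    (hneg : ∀ t ∈ Ioo a b, y t ≤ 0 → ∀ᶠ u in 𝓝 t, F u < 0) :
    ∀ t ∈ Ioo a b, 0 < y t := by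
  have hmem : ∀ u ∈ Icc (-b) (-a), -u ∈ Icc a b := fun u hu =>
    ⟨by linarith [hu.2], by linarith [hu.1]⟩
  have key := pos_of_integral_of_eventually_pos (a := -b) (b := -a)
    (F := fun u => -F (-u)) (y := fun u => y (-u))
    (hy.comp continuous_neg.continuousOn hmem)
    (by
      have h1 := (Measure.measurePreserving_neg (volume : Measure ℝ)).integrableOn_comp_preimage
        (MeasurableEquiv.neg ℝ).measurableEmbedding (f := F) (s := Icc a b)
      have h2 := h1.2 hF
      simp only [neg_preimage, neg_Icc] at h2
      exact h2.neg)
    (by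
      intro u hu v hv
      rw [intervalIntegral.integral_neg, intervalIntegral.integral_comp_neg (f := F),
        ← hint _ (hmem v hv) _ (hmem u hu)]
      ring)
    (by simpa using hb)
    (by
      intro t ht hyt
      have h1 := hneg (-t) ⟨by linarith [ht.2], by linarith [ht.1]⟩ hyt
      filter_upwards [(continuous_neg.tendsto t).eventually h1] with u hu
      simpa using hu)
  intro t ht
  simpa using key (-t) ⟨by linarith [ht.2], by linarith [ht.1]⟩

/-- Near a zero of `max y 0`, a bounded multiple of a positive power of `max y 0` is small. -/
theorem eventually_abs_mul_rpow_lt {g y : ℝ → ℝ} {K r t ε : ℝ} (hr : 0 < r) (hε : 0 < ε)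
    (hg : ∀ᶠ u in 𝓝 t, |g u| ≤ K) (hy : ContinuousAt y t) (hyt : y t ≤ 0) :
    ∀ᶠ u in 𝓝 t, |g u * (max (y u) 0) ^ r| < ε := by
  have hlim : Tendsto (fun u => K * (max (y u) 0) ^ r) (𝓝 t) (𝓝 0) := by
    have h1 : ContinuousAt (fun u => K * (max (y u) 0) ^ r) t :=
      continuousAt_const.mul ((hy.max continuousAt_const).rpow_const (Or.inr hr.le))
    simpa [ContinuousAt, max_eq_right hyt, Real.zero_rpow hr.ne'] using h1
  filter_upwards [hg, hlim.eventually_lt_const hε] with u hgu hu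
  have h0 : 0 ≤ (max (y u) 0) ^ r := by positivity
  rw [abs_mul, abs_of_nonneg h0]
  exact (mul_le_mul_of_nonneg_right hgu h0).trans_lt hu

/-- The right-hand side of the ODE is integrable along a continuous function. -/
theorem integrableOn_mul_rpow_sub {a b q r K : ℝ} {g f y : ℝ → ℝ} (hr : 0 ≤ r)
    (hg : Measurable g) (hK : ∀ t ∈ Icc a b, |g t| ≤ K) (hy : ContinuousOn y (Icc a b))
    (hf : IntegrableOn f (Icc a b)) :
    IntegrableOn (fun u => q * (g u * (max (y u) 0) ^ r - f u)) (Icc a b) := by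
  have hc : ContinuousOn (fun u => (max (y u) 0) ^ r) (Icc a b) :=
    (hy.sup continuousOn_const).rpow_const fun _ _ => Or.inr hr
  have hi : IntegrableOn (fun u => g u * (max (y u) 0) ^ r) (Icc a b) :=
    (hc.integrableOn_compact isCompact_Icc).bdd_mul hg.aestronglyMeasurable (c := K) <|
      (ae_restrict_iff' measurableSet_Icc).2 (.of_forall hK)
  exact (hi.sub hf).const_mul q

theorem stmt_2
    (p p' s : ℝ) (h f : ℝ → ℝ)
    (hp : 1 < p) (hp'def : p' = p / (p - 1))
    (hs : s ∈ Set.Ioo (0:ℝ) 1)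
    (hmeas : Measurable h)
    (hbd : ∃ M : ℝ, ∀ t ∈ Set.Icc (0:ℝ) 1, |h t| ≤ M)
    (hfint : MeasureTheory.IntegrableOn f (Set.Ioo (0:ℝ) 1))
    (hf0 : f 0 = 0) (hfs : f s = 0) (hf1 : f 1 = 0)
    (hfneg : ∀ t ∈ Set.Ioo (0:ℝ) s, f t < 0)
    (hfpos : ∀ t ∈ Set.Ioo s (1:ℝ), 0 < f t)
    (husc : UpperSemicontinuousOn f (Set.Ioo (0:ℝ) s))
    (hlsc : LowerSemicontinuousOn f (Set.Ioo s (1:ℝ)))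
    (c : ℝ) :
    (∀ y, IsCaraSol p p' h f c 0 1 y → y 0 = 0 → ∀ t ∈ Set.Ioo (0:ℝ) s, 0 < y t) ∧
    (∀ y, IsCaraSol p p' h f c 0 1 y → y 1 = 0 → ∀ t ∈ Set.Ioo s (1:ℝ), 0 < y t) := by
  obtain ⟨M, hM⟩ := hbd
  have hr : 0 < 1 / p := by positivity
  have hp' : 0 < p' := by
    rw [hp'def]
    exact div_pos (by linarith) (by linarith)
  have hK : ∀ t ∈ Icc (0:ℝ) 1, |c - h t| ≤ |c| + M := fun t ht =>
    (abs_sub c (h t)).trans (add_le_add le_rfl (hM t ht))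
  have hf : IntegrableOn f (Icc (0:ℝ) 1) := by
    rwa [integrableOn_Icc_iff_integrableOn_Ioo]
  have hF : ∀ {y : ℝ → ℝ}, ContinuousOn y (Icc 0 1) → IntegrableOn
      (fun u => p' * ((c - h u) * (max (y u) 0) ^ (1 / p) - f u)) (Icc 0 1) := fun hy =>
    integrableOn_mul_rpow_sub hr.le (measurable_const.sub hmeas) hK hy hf
  have hint : ∀ {y : ℝ → ℝ}, IsCaraSol p p' h f c 0 1 y → ∀ u ∈ Icc (0:ℝ) 1, ∀ v ∈ Icc (0:ℝ) 1,
      y v - y u = ∫ x in u..v, p' * ((c - h x) * (max (y x) 0) ^ (1 / p) - f x) := by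
    intro y hy u hu v hv
    have hI : ∀ w ∈ Icc (0:ℝ) 1, IntervalIntegrable
        (fun x => p' * ((c - h x) * (max (y x) 0) ^ (1 / p) - f x)) volume 0 w := by
      intro w hw
      rw [intervalIntegrable_iff_integrableOn_Icc_of_le hw.1]
      exact (hF hy.1).mono_set (Icc_subset_Icc_right hw.2)
    rw [hy.2 v hv, hy.2 u hu, ← integral_interval_sub_left (hI v hv) (hI u hu)]
    ring
  have hsmall : ∀ {y : ℝ → ℝ}, ContinuousOn y (Icc 0 1) → ∀ t ∈ Ioo (0:ℝ) 1, y t ≤ 0 →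
      ∀ ε > 0, ∀ᶠ u in 𝓝 t, |(c - h u) * (max (y u) 0) ^ (1 / p)| < ε := by
    intro y hy t ht hyt ε hε
    have hnhds : Icc (0:ℝ) 1 ∈ 𝓝 t := Icc_mem_nhds ht.1 ht.2
    exact eventually_abs_mul_rpow_lt hr hε (Filter.mem_of_superset hnhds hK)
      (hy.continuousAt hnhds) hyt
  have hsub₀ : Icc 0 s ⊆ Icc (0:ℝ) 1 := Icc_subset_Icc_right hs.2.le
  have hsub₁ : Icc s 1 ⊆ Icc (0:ℝ) 1 := Icc_subset_Icc_left hs.1.le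
  constructor
  · intro y hy hy0
    refine pos_of_integral_of_eventually_pos (hy.1.mono hsub₀) ((hF hy.1).mono_set hsub₀)
      (fun u hu v hv => hint hy u (hsub₀ hu) v (hsub₀ hv)) hy0.ge fun t ht hyt => ?_
    have hft := hfneg t ht
    have hev := husc t ht (f t / 2) (by linarith)
    rw [isOpen_Ioo.nhdsWithin_eq ht] at hev
    filter_upwards [hev, hsmall hy.1 t ⟨ht.1, ht.2.trans hs.2⟩ hyt (-(f t / 2)) (by linarith)]
      with u hfu hu
    exact mul_pos hp' (by linarith [(abs_lt.1 hu).1])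
  · intro y hy hy1
    refine pos_of_integral_of_eventually_neg (hy.1.mono hsub₁) ((hF hy.1).mono_set hsub₁)
      (fun u hu v hv => hint hy u (hsub₁ hu) v (hsub₁ hv)) hy1.ge fun t ht hyt => ?_
    have hft := hfpos t ht
    have hev := hlsc t ht (f t / 2) (by linarith)
    rw [isOpen_Ioo.nhdsWithin_eq ht] at hev
    filter_upwards [hev, hsmall hy.1 t ⟨hs.1.trans ht.1, ht.2⟩ hyt (f t / 2) (by linarith)]
      with u hfu hu
    exact mul_neg_of_pos_of_neg hp' (by linarith [(abs_lt.1 hu).2])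
end
end

section
/- Fix c ∈ ℝ. If y₁ and y₂ are Carathéodory solutions on [0, s_*] of the ODE with y₁(0) = y₂(0) = 0 and y₁(t) > 0, y₂(t) > 0 for all t ∈ (0, s_*), then y₁ = y₂ on [0, s_*]. Likewise, if y₁ and y₂ are Carathéodory solutions on [s_*, 1] of the ODE with y₁(1) = y₂(1) = 0 and y₁(t) > 0, y₂(t) > 0 for all t ∈ (s_*, 1), then y₁ = y₂ on [s_*, 1]. -/
open MeasureTheory Set Filter Topology intervalIntegral

noncomputable section

/-- A function whose increments are dominated by those of an absolutely continuous function is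
absolutely continuous. -/
theorem AbsolutelyContinuousOnInterval.of_dist_le {F G : ℝ → ℝ} {a b K : ℝ}
    (hG : AbsolutelyContinuousOnInterval G a b)
    (hFG : ∀ x ∈ uIcc a b, ∀ y ∈ uIcc a b, dist (F x) (F y) ≤ K * dist (G x) (G y)) :
    AbsolutelyContinuousOnInterval F a b := by
  have hlim := Tendsto.const_mul K hG
  rw [mul_zero] at hlim
  refine squeeze_zero' (Eventually.of_forall fun E => Finset.sum_nonneg fun i _ => dist_nonneg)
    ?_ hlim
  filter_upwards [mem_inf_of_right (mem_principal_self _)] with E hE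
  rw [Finset.mul_sum]
  refine Finset.sum_le_sum fun i hi => ?_
  have hmem := hE.1 i hi
  exact hFG _ hmem.1 _ hmem.2

theorem AbsolutelyContinuousOnInterval.le_of_ae_deriv_nonpos {F : ℝ → ℝ} {a b : ℝ} (hab : a ≤ b)
    (hF : AbsolutelyContinuousOnInterval F a b) (hd : ∀ᵐ x, x ∈ Icc a b → deriv F x ≤ 0) :
    F b ≤ F a := by
  have hint : ∫ x in a..b, deriv F x ≤ 0 := by
    rw [intervalIntegral.integral_of_le hab]
    refine setIntegral_nonpos_ae measurableSet_Ioc ?_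
    filter_upwards [hd] with x hx hxm using hx (Ioc_subset_Icc_self hxm)
  rw [hF.integral_deriv_eq_sub] at hint
  linarith

theorem intervalIntegrable_rhs {p p' c a b : ℝ} {h f y : ℝ → ℝ} (hp : 1 < p) (hab : a ≤ b)
    (hmeas : Measurable h) (hbd : ∃ M : ℝ, ∀ t ∈ Icc a b, |h t| ≤ M)
    (hf : IntegrableOn f (Ioo a b)) (hy : ContinuousOn y (Icc a b)) :
    IntervalIntegrable (fun u => p' * ((c - h u) * (max (y u) 0) ^ (1 / p) - f u)) volume a b := by
  obtain ⟨M, hM⟩ := hbd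
  have hh : IntervalIntegrable h volume a b := by
    rw [intervalIntegrable_iff_integrableOn_Icc_of_le hab]
    refine Measure.integrableOn_of_bounded (M := M) (by simp) hmeas.aestronglyMeasurable ?_
    exact (ae_restrict_iff' measurableSet_Icc).2 (Eventually.of_forall hM)
  have hf' : IntervalIntegrable f volume a b :=
    (intervalIntegrable_iff_integrableOn_Ioo_of_le hab).2 hf
  have hcont : ContinuousOn (fun u => (max (y u) 0) ^ (1 / p)) (uIcc a b) := by
    rw [uIcc_of_le hab]
    exact (ContinuousOn.sup hy continuousOn_const).rpow_const fun _ _ => Or.inr (by positivity)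
  exact (((intervalIntegrable_const.sub hh).mul_continuousOn hcont).sub hf').const_mul p'

/-- Under the substitution `z = y ^ (1 - 1 / p)` a positive solution is absolutely continuous on
compact subintervals and satisfies `z' = (c - h) - f * y ^ (-(1 / p))` almost everywhere. -/
theorem IsCaraSol.rpow_absolutelyContinuous {p p' c a b u v : ℝ} {h f y : ℝ → ℝ} (hp : 1 < p)
    (hp' : p' = p / (p - 1)) (hmeas : Measurable h) (hbd : ∃ M : ℝ, ∀ t ∈ Icc a b, |h t| ≤ M)
    (hf : IntegrableOn f (Ioo a b)) (hy : IsCaraSol p p' h f c a b y)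
    (hpos : ∀ t ∈ Ioo a b, 0 < y t) (hau : a < u) (huv : u ≤ v) (hvb : v < b) :
    AbsolutelyContinuousOnInterval (fun t => y t ^ (1 - 1 / p)) u v ∧
      ∀ᵐ x, x ∈ Icc u v →
        HasDerivAt (fun t => y t ^ (1 - 1 / p)) (c - h x - f x * y x ^ (-(1 / p))) x := by
  have hab : a ≤ b := by linarith
  obtain ⟨hcont, heq⟩ := hy
  have hsub : Icc u v ⊆ Ioo a b := Icc_subset_Ioo hau hvb
  have hsub' : Icc u v ⊆ Icc a b := hsub.trans Ioo_subset_Icc_self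
  have hint := intervalIntegrable_rhs (p' := p') (c := c) hp hab hmeas hbd hf hcont
  constructor
  · have hG := (hint.absolutelyContinuousOnInterval_intervalIntegral left_mem_uIcc).mono
      (c := u) (d := v) (by rwa [uIcc_of_le hab, uIcc_of_le huv])
    obtain ⟨x₀, hx₀, hmin⟩ := isCompact_Icc.exists_isMinOn (nonempty_Icc.2 huv) (hcont.mono hsub')
    obtain ⟨x₁, hx₁, hmax⟩ := isCompact_Icc.exists_isMaxOn (nonempty_Icc.2 huv) (hcont.mono hsub')
    have hsmooth : ContDiffOn ℝ 1 (fun x : ℝ => x ^ (1 - 1 / p)) (Icc (y x₀) (y x₁)) := fun x hx =>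
      (Real.contDiffAt_rpow_const_of_ne ((hpos x₀ (hsub hx₀)).trans_le hx.1).ne').contDiffWithinAt
    obtain ⟨K, hK⟩ := hsmooth.exists_lipschitzOnWith (by decide) (convex_Icc _ _) isCompact_Icc
    refine hG.of_dist_le (K := K) fun x hx t ht => ?_
    rw [uIcc_of_le huv] at hx ht
    refine (hK.dist_le_mul _ ⟨hmin hx, hmax hx⟩ _ ⟨hmin ht, hmax ht⟩).trans_eq ?_
    rw [heq x (hsub' hx), heq t (hsub' ht), dist_add_left]
  · filter_upwards [hint.ae_hasDerivAt_integral] with x hx hxm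
    have hxab := hsub hxm
    have hyx := hpos x hxab
    have hder := (hx (by rw [uIcc_of_le hab]; exact hsub' hxm) a left_mem_uIcc).const_add (y a)
    have hdery := hder.congr_of_eventuallyEq (f₁ := y) (by
      filter_upwards [Icc_mem_nhds hxab.1 hxab.2] with t ht using heq t ht)
    convert! hdery.rpow_const (p := 1 - 1 / p) (Or.inl hyx.ne') using 1
    rw [max_eq_left hyx.le, show 1 - 1 / p - 1 = -(1 / p) by ring, hp']
    have hinv : y x ^ (1 / p) * y x ^ (-(1 / p)) = 1 := by
      rw [← Real.rpow_add hyx, add_neg_cancel, Real.rpow_zero]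
    have hcoef : p / (p - 1) * (1 - 1 / p) = 1 := by
      have h1 : p - 1 ≠ 0 := by linarith
      have h2 : p ≠ 0 := by linarith
      field_simp
    linear_combination (-(c - h x)) * hinv - ((c - h x) * (y x ^ (1 / p) * y x ^ (-(1 / p)))
      - f x * y x ^ (-(1 / p))) * hcoef

theorem rpow_sub_mul_rpow_neg_sub_nonpos {r q x y : ℝ} (hr : 0 ≤ r) (hq : 0 ≤ q) (hx : 0 < x)
    (hy : 0 < y) : (x ^ r - y ^ r) * (x ^ (-q) - y ^ (-q)) ≤ 0 := by
  rcases le_total x y with hxy | hxy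
  · exact mul_nonpos_of_nonpos_of_nonneg
      (sub_nonpos.2 (Real.rpow_le_rpow hx.le hxy hr))
      (sub_nonneg.2 (Real.rpow_le_rpow_of_nonpos hx hxy (neg_nonpos.2 hq)))
  · exact mul_nonpos_of_nonneg_of_nonpos
      (sub_nonneg.2 (Real.rpow_le_rpow hy.le hxy hr))
      (sub_nonpos.2 (Real.rpow_le_rpow_of_nonpos hy hxy (neg_nonpos.2 hq)))

/-- The squared distance of two positive solutions in the variable `z = y ^ (1 - 1 / p)`. -/
def solGap (p : ℝ) (y₁ y₂ : ℝ → ℝ) (t : ℝ) : ℝ :=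
  (y₁ t ^ (1 - 1 / p) - y₂ t ^ (1 - 1 / p)) * (y₁ t ^ (1 - 1 / p) - y₂ t ^ (1 - 1 / p))

/-- The derivative of the squared distance of two positive solutions is a nonnegative multiple
of `f`. -/
theorem solGap_absolutelyContinuous {p p' c a b u v : ℝ} {h f y₁ y₂ : ℝ → ℝ} (hp : 1 < p)
    (hp' : p' = p / (p - 1)) (hmeas : Measurable h) (hbd : ∃ M : ℝ, ∀ t ∈ Icc a b, |h t| ≤ M)
    (hf : IntegrableOn f (Ioo a b)) (hy₁ : IsCaraSol p p' h f c a b y₁)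
    (hy₂ : IsCaraSol p p' h f c a b y₂) (hpos₁ : ∀ t ∈ Ioo a b, 0 < y₁ t)
    (hpos₂ : ∀ t ∈ Ioo a b, 0 < y₂ t) (hau : a < u) (huv : u ≤ v) (hvb : v < b) :
    AbsolutelyContinuousOnInterval (solGap p y₁ y₂) u v ∧
      ∀ᵐ x, x ∈ Icc u v → ∃ k, 0 ≤ k ∧ HasDerivAt (solGap p y₁ y₂) (f x * k) x := by
  obtain ⟨hac₁, hd₁⟩ := hy₁.rpow_absolutelyContinuous hp hp' hmeas hbd hf hpos₁ hau huv hvb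
  obtain ⟨hac₂, hd₂⟩ := hy₂.rpow_absolutelyContinuous hp hp' hmeas hbd hf hpos₂ hau huv hvb
  refine ⟨(hac₁.sub hac₂).mul (hac₁.sub hac₂), ?_⟩
  filter_upwards [hd₁, hd₂] with x hx₁ hx₂ hx
  have hxab := Icc_subset_Ioo hau hvb hx
  have hr : 0 ≤ 1 - 1 / p := sub_nonneg.2 ((div_le_one (by linarith)).2 hp.le)
  have hk := rpow_sub_mul_rpow_neg_sub_nonpos (q := 1 / p) hr (by positivity) (hpos₁ x hxab)
    (hpos₂ x hxab)
  refine ⟨-2 * ((y₁ x ^ (1 - 1 / p) - y₂ x ^ (1 - 1 / p)) *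
    (y₁ x ^ (-(1 / p)) - y₂ x ^ (-(1 / p)))), by linarith, ?_⟩
  have hd := (hx₁ hx).sub (hx₂ hx)
  convert! hd.mul hd using 1
  simp only [Pi.sub_apply]
  ring

theorem solGap_continuousOn {p a b : ℝ} {y₁ y₂ : ℝ → ℝ} (hp : 1 < p)
    (hy₁ : ContinuousOn y₁ (Icc a b)) (hy₂ : ContinuousOn y₂ (Icc a b)) :
    ContinuousOn (solGap p y₁ y₂) (Icc a b) := by
  have hr : 0 ≤ 1 - 1 / p := sub_nonneg.2 ((div_le_one (by linarith)).2 hp.le)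
  have hd := (hy₁.rpow_const fun _ _ => Or.inr hr).sub (hy₂.rpow_const fun _ _ => Or.inr hr)
  exact hd.mul hd

theorem eqOn_of_solGap_nonpos {p a b : ℝ} {y₁ y₂ : ℝ → ℝ} (hp : 1 < p) (hab : a < b)
    (hy₁ : ContinuousOn y₁ (Icc a b)) (hy₂ : ContinuousOn y₂ (Icc a b))
    (hpos₁ : ∀ t ∈ Ioo a b, 0 < y₁ t) (hpos₂ : ∀ t ∈ Ioo a b, 0 < y₂ t)
    (hgap : ∀ t ∈ Ioo a b, solGap p y₁ y₂ t ≤ 0) : EqOn y₁ y₂ (Icc a b) := by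
  have hr : 0 < 1 - 1 / p := sub_pos.2 ((div_lt_one (by linarith)).2 hp)
  refine EqOn.of_subset_closure (s := Ioo a b) (fun t ht => ?_) hy₁ hy₂ Ioo_subset_Icc_self
    (closure_Ioo hab.ne).ge
  have hzero := mul_self_eq_zero.1 (le_antisymm (hgap t ht) (mul_self_nonneg _))
  exact (Real.rpow_left_inj (hpos₁ t ht).le (hpos₂ t ht).le hr.ne').1 (sub_eq_zero.1 hzero)

theorem eqOn_of_eq_left {p p' c a b : ℝ} {h f y₁ y₂ : ℝ → ℝ} (hp : 1 < p)
    (hp' : p' = p / (p - 1)) (hab : a < b) (hmeas : Measurable h)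
    (hbd : ∃ M : ℝ, ∀ t ∈ Icc a b, |h t| ≤ M) (hf : IntegrableOn f (Ioo a b))
    (hfneg : ∀ t ∈ Ioo a b, f t ≤ 0) (hy₁ : IsCaraSol p p' h f c a b y₁)
    (hy₂ : IsCaraSol p p' h f c a b y₂) (hpos₁ : ∀ t ∈ Ioo a b, 0 < y₁ t)
    (hpos₂ : ∀ t ∈ Ioo a b, 0 < y₂ t) (hya : y₁ a = y₂ a) : EqOn y₁ y₂ (Icc a b) := by
  refine eqOn_of_solGap_nonpos hp hab hy₁.1 hy₂.1 hpos₁ hpos₂ fun t ht => ?_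
  have hlim : Tendsto (solGap p y₁ y₂) (𝓝[>] a) (𝓝 0) := by
    have hc := ((solGap_continuousOn hp hy₁.1 hy₂.1) a (left_mem_Icc.2 hab.le)).mono_left
      (nhdsWithin_le_iff.2 (Icc_mem_nhdsGT hab))
    simpa [solGap, hya] using hc
  refine ge_of_tendsto hlim ?_
  filter_upwards [Ioo_mem_nhdsGT ht.1] with u hu
  obtain ⟨hac, hd⟩ := solGap_absolutelyContinuous hp hp' hmeas hbd hf hy₁ hy₂ hpos₁ hpos₂ hu.1
    hu.2.le ht.2
  refine hac.le_of_ae_deriv_nonpos hu.2.le ?_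
  filter_upwards [hd] with x hx hxm
  obtain ⟨k, hk, hder⟩ := hx hxm
  rw [hder.deriv]
  exact mul_nonpos_of_nonpos_of_nonneg (hfneg x (Icc_subset_Ioo hu.1 ht.2 hxm)) hk

theorem eqOn_of_eq_right {p p' c a b : ℝ} {h f y₁ y₂ : ℝ → ℝ} (hp : 1 < p)
    (hp' : p' = p / (p - 1)) (hab : a < b) (hmeas : Measurable h)
    (hbd : ∃ M : ℝ, ∀ t ∈ Icc a b, |h t| ≤ M) (hf : IntegrableOn f (Ioo a b))
    (hfpos : ∀ t ∈ Ioo a b, 0 ≤ f t) (hy₁ : IsCaraSol p p' h f c a b y₁)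
    (hy₂ : IsCaraSol p p' h f c a b y₂) (hpos₁ : ∀ t ∈ Ioo a b, 0 < y₁ t)
    (hpos₂ : ∀ t ∈ Ioo a b, 0 < y₂ t) (hyb : y₁ b = y₂ b) : EqOn y₁ y₂ (Icc a b) := by
  refine eqOn_of_solGap_nonpos hp hab hy₁.1 hy₂.1 hpos₁ hpos₂ fun t ht => ?_
  have hlim : Tendsto (solGap p y₁ y₂) (𝓝[<] b) (𝓝 0) := by
    have hc := ((solGap_continuousOn hp hy₁.1 hy₂.1) b (right_mem_Icc.2 hab.le)).mono_left
      (nhdsWithin_le_iff.2 (Icc_mem_nhdsLT hab))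
    simpa [solGap, hyb] using hc
  refine ge_of_tendsto hlim ?_
  filter_upwards [Ioo_mem_nhdsLT ht.2] with v hv
  obtain ⟨hac, hd⟩ := solGap_absolutelyContinuous hp hp' hmeas hbd hf hy₁ hy₂ hpos₁ hpos₂ ht.1
    hv.1.le hv.2
  suffices hneg : (-solGap p y₁ y₂) v ≤ (-solGap p y₁ y₂) t from neg_le_neg_iff.1 hneg
  refine hac.neg.le_of_ae_deriv_nonpos hv.1.le ?_
  filter_upwards [hd] with x hx hxm
  obtain ⟨k, hk, hder⟩ := hx hxm
  rw [hder.neg.deriv]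
  exact neg_nonpos.2 (mul_nonneg (hfpos x (Icc_subset_Ioo ht.1 hv.2 hxm)) hk)

theorem stmt_3
    (p p' s : ℝ) (h f : ℝ → ℝ)
    (hp : 1 < p) (hp'def : p' = p / (p - 1))
    (hs : s ∈ Set.Ioo (0:ℝ) 1)
    (hmeas : Measurable h)
    (hbd : ∃ M : ℝ, ∀ t ∈ Set.Icc (0:ℝ) 1, |h t| ≤ M)
    (hfint : MeasureTheory.IntegrableOn f (Set.Ioo (0:ℝ) 1))
    (hf0 : f 0 = 0) (hfs : f s = 0) (hf1 : f 1 = 0)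
    (hfneg : ∀ t ∈ Set.Ioo (0:ℝ) s, f t < 0)
    (hfpos : ∀ t ∈ Set.Ioo s (1:ℝ), 0 < f t)
    (husc : UpperSemicontinuousOn f (Set.Ioo (0:ℝ) s))
    (hlsc : LowerSemicontinuousOn f (Set.Ioo s (1:ℝ)))
    (c : ℝ) :
    (∀ y₁ y₂, IsCaraSol p p' h f c 0 s y₁ → IsCaraSol p p' h f c 0 s y₂ →
      y₁ 0 = 0 → y₂ 0 = 0 →
      (∀ t ∈ Set.Ioo (0:ℝ) s, 0 < y₁ t) → (∀ t ∈ Set.Ioo (0:ℝ) s, 0 < y₂ t) →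
      Set.EqOn y₁ y₂ (Set.Icc 0 s)) ∧
    (∀ y₁ y₂, IsCaraSol p p' h f c s 1 y₁ → IsCaraSol p p' h f c s 1 y₂ →
      y₁ 1 = 0 → y₂ 1 = 0 →
      (∀ t ∈ Set.Ioo s (1:ℝ), 0 < y₁ t) → (∀ t ∈ Set.Ioo s (1:ℝ), 0 < y₂ t) →
      Set.EqOn y₁ y₂ (Set.Icc s 1)) := by
  obtain ⟨M, hM⟩ := hbd
  have hl : Icc 0 s ⊆ Icc (0 : ℝ) 1 := Icc_subset_Icc_right hs.2.le
  have hr : Icc s 1 ⊆ Icc (0 : ℝ) 1 := Icc_subset_Icc_left hs.1.le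
  constructor
  · intro y₁ y₂ hy₁ hy₂ h₁ h₂ hpos₁ hpos₂
    exact eqOn_of_eq_left hp hp'def hs.1 hmeas ⟨M, fun t ht => hM t (hl ht)⟩
      (hfint.mono_set (Ioo_subset_Ioo_right hs.2.le)) (fun t ht => (hfneg t ht).le) hy₁ hy₂
      hpos₁ hpos₂ (h₁.trans h₂.symm)
  · intro y₁ y₂ hy₁ hy₂ h₁ h₂ hpos₁ hpos₂
    exact eqOn_of_eq_right hp hp'def hs.2 hmeas ⟨M, fun t ht => hM t (hr ht)⟩
      (hfint.mono_set (Ioo_subset_Ioo_left hs.1.le)) (fun t ht => (hfpos t ht).le) hy₁ hy₂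
      hpos₁ hpos₂ (h₁.trans h₂.symm)
end
end

section
/- Fix c ∈ ℝ and t_* ∈ (s_*, 1). If y₁ and y₂ are Carathéodory solutions on [0, t_*] of the ODE with y₁(0) = y₂(0) = 0 and y₁(t) > 0, y₂(t) > 0 for all t ∈ (0, t_*), then y₁ = y₂ on [0, t_*]. -/
open MeasureTheory Set Filter Topology intervalIntegral

noncomputable section

namespace AbsolutelyContinuousOnInterval

theorem congr {X : Type*} [PseudoMetricSpace X] {f g : ℝ → X} {a b : ℝ}
    (hf : AbsolutelyContinuousOnInterval f a b) (hfg : EqOn f g (uIcc a b)) :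
    AbsolutelyContinuousOnInterval g a b := by
  rw [absolutelyContinuousOnInterval_iff] at hf ⊢
  intro ε hε
  obtain ⟨δ, hδ, H⟩ := hf ε hε
  refine ⟨δ, hδ, fun E hE hlt => ?_⟩
  convert! H E hE hlt using 1
  refine Finset.sum_congr rfl fun i hi => ?_
  obtain ⟨h₁, h₂⟩ := hE.1 i hi
  rw [hfg h₁, hfg h₂]

theorem lipschitzOnWith_comp {X Y : Type*} [PseudoMetricSpace X] [PseudoMetricSpace Y]
    {f : ℝ → X} {φ : X → Y} {a b : ℝ} {K : NNReal}
    (hφ : LipschitzOnWith K φ (f '' uIcc a b)) (hf : AbsolutelyContinuousOnInterval f a b) :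
    AbsolutelyContinuousOnInterval (φ ∘ f) a b := by
  rw [absolutelyContinuousOnInterval_iff] at hf ⊢
  intro ε hε
  obtain ⟨δ, hδ, H⟩ := hf (ε / (K + 1)) (by positivity)
  refine ⟨δ, hδ, fun E hE hlt => ?_⟩
  have h := H E hE hlt
  rw [lt_div_iff₀ (by positivity)] at h
  refine lt_of_le_of_lt ?_ h
  rw [Finset.sum_mul]
  refine Finset.sum_le_sum fun i hi => ?_
  obtain ⟨h₁, h₂⟩ := hE.1 i hi
  have h₃ := hφ.dist_le_mul _ (mem_image_of_mem f h₁) _ (mem_image_of_mem f h₂)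
  have h₄ : 0 ≤ dist (f (E.2 i).1) (f (E.2 i).2) := dist_nonneg
  simp only [Function.comp]
  nlinarith

theorem contDiffOn_comp {f φ : ℝ → ℝ} {a b : ℝ}
    (hφ : ContDiffOn ℝ 1 φ (f '' uIcc a b)) (hf : AbsolutelyContinuousOnInterval f a b) :
    AbsolutelyContinuousOnInterval (φ ∘ f) a b := by
  obtain ⟨K, hK⟩ := hφ.exists_lipschitzOnWith (by decide)
    (isPreconnected_uIcc.image f hf.continuousOn).ordConnected.convex
    (isCompact_uIcc.image_of_continuousOn hf.continuousOn)
  exact lipschitzOnWith_comp hK hf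

theorem le_of_ae_hasDerivAt_nonpos {f f' : ℝ → ℝ} {a b : ℝ} (hab : a ≤ b)
    (hf : AbsolutelyContinuousOnInterval f a b)
    (h : ∀ᵐ x, x ∈ Ioo a b → HasDerivAt f (f' x) x ∧ f' x ≤ 0) : f b ≤ f a := by
  rw [← sub_nonpos, ← hf.integral_deriv_eq_sub, integral_of_le hab,
    integral_Ioc_eq_integral_Ioo]
  refine integral_nonpos_of_ae ?_
  rw [EventuallyLE, ae_restrict_iff' measurableSet_Ioo]
  filter_upwards [h] with x hx hxab
  rw [(hx hxab).1.deriv]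
  exact (hx hxab).2

end AbsolutelyContinuousOnInterval

namespace IsCaraSol

variable {p p' c a b : ℝ} {h f y : ℝ → ℝ}

theorem intervalIntegrable (hy : IsCaraSol p p' h f c a b y) (hab : a ≤ b) (hp : 0 ≤ p)
    (hmeas : Measurable h) {M : ℝ} (hbd : ∀ t ∈ Icc a b, |h t| ≤ M)
    (hf : IntervalIntegrable f volume a b) :
    IntervalIntegrable (fun u => p' * ((c - h u) * (max (y u) 0) ^ (1 / p) - f u)) volume a b := by
  have hh : IntervalIntegrable (fun u => c - h u) volume a b := by
    refine intervalIntegrable_const.sub ?_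
    rw [intervalIntegrable_iff_integrableOn_Icc_of_le hab]
    refine Measure.integrableOn_of_bounded (M := M) (by simp) hmeas.aestronglyMeasurable ?_
    filter_upwards [ae_restrict_mem measurableSet_Icc] with t ht
    exact hbd t ht
  refine ((hh.mul_continuousOn ?_).sub hf).const_mul p'
  rw [uIcc_of_le hab]
  exact (hy.1.sup continuousOn_const).rpow_const fun x _ => Or.inr (by positivity)

theorem absolutelyContinuousOnInterval (hy : IsCaraSol p p' h f c a b y) (hab : a ≤ b)
    (hint : IntervalIntegrable (fun u => p' * ((c - h u) * (max (y u) 0) ^ (1 / p) - f u))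
      volume a b) :
    AbsolutelyContinuousOnInterval y a b := by
  have hconst : AbsolutelyContinuousOnInterval (fun _ : ℝ => y a) a b :=
    contDiffOn_const.absolutelyContinuousOnInterval
  refine (hconst.add (hint.absolutelyContinuousOnInterval_intervalIntegral
    left_mem_uIcc)).congr fun t ht => ?_
  rw [uIcc_of_le hab] at ht
  exact (hy.2 t ht).symm

theorem ae_hasDerivAt (hy : IsCaraSol p p' h f c a b y) (hab : a ≤ b)
    (hint : IntervalIntegrable (fun u => p' * ((c - h u) * (max (y u) 0) ^ (1 / p) - f u))
      volume a b) :
    ∀ᵐ t, t ∈ Ioo a b →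
      HasDerivAt y (p' * ((c - h t) * (max (y t) 0) ^ (1 / p) - f t)) t := by
  filter_upwards [hint.ae_hasDerivAt_integral] with t ht htab
  rw [uIcc_of_le hab] at ht
  have hd := (ht (Ioo_subset_Icc_self htab) a (left_mem_Icc.2 hab)).const_add (y a)
  refine hd.congr_of_eventuallyEq ?_
  filter_upwards [Icc_mem_nhds htab.1 htab.2] with u hu
  exact hy.2 u hu

end IsCaraSol

theorem Real.sub_rpow_mul_sub_rpow_neg_nonpos {x y q r : ℝ} (hx : 0 < x) (hy : 0 < y)
    (hq : 0 ≤ q) (hr : 0 ≤ r) : (x ^ q - y ^ q) * (x ^ (-r) - y ^ (-r)) ≤ 0 := by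
  rcases le_total x y with hxy | hxy
  · exact mul_nonpos_of_nonpos_of_nonneg
      (sub_nonpos.2 (Real.rpow_le_rpow hx.le hxy hq))
      (sub_nonneg.2 (Real.rpow_le_rpow_of_nonpos hx hxy (neg_nonpos.2 hr)))
  · exact mul_nonpos_of_nonneg_of_nonpos
      (sub_nonneg.2 (Real.rpow_le_rpow hy.le hxy hq))
      (sub_nonpos.2 (Real.rpow_le_rpow_of_nonpos hy hxy (neg_nonpos.2 hr)))

/-- The power `y ^ (1 - 1 / p)` of a positive solution turns the equation into
`w' = (c - h) - f * y ^ (-(1 / p))`. -/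
theorem HasDerivAt.rpow_caraSol {p p' c : ℝ} {h f y : ℝ → ℝ} {t : ℝ} (hp : 1 < p)
    (hp' : p' = p / (p - 1)) (hpos : 0 < y t)
    (hy : HasDerivAt y (p' * ((c - h t) * (max (y t) 0) ^ (1 / p) - f t)) t) :
    HasDerivAt (fun u => y u ^ (1 - 1 / p)) ((c - h t) - f t * y t ^ (-(1 / p))) t := by
  convert! hy.rpow_const (p := 1 - 1 / p) (Or.inl hpos.ne') using 1
  have hq : p' * (1 - 1 / p) = 1 := by
    have := sub_pos.2 hp
    rw [hp']
    field_simp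
  have hr : y t ^ (1 / p) * y t ^ (-(1 / p)) = 1 := by
    rw [← Real.rpow_add hpos, add_neg_cancel, Real.rpow_zero]
  rw [max_eq_left hpos.le, show 1 - 1 / p - 1 = -(1 / p) by ring]
  linear_combination (-(c - h t)) * hr - ((c - h t) * y t ^ (1 / p) - f t) * y t ^ (-(1 / p)) * hq

/-- Where `f ≤ 0`, two solutions that vanish at the left endpoint and are positive afterwards
coincide. -/
theorem IsCaraSol.eq_of_nonpos {p p' c b : ℝ} {h f y₁ y₂ : ℝ → ℝ} (hp : 1 < p)
    (hp' : p' = p / (p - 1)) (hb : 0 < b) (hf : ∀ t ∈ Ioo 0 b, f t ≤ 0)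
    (hc₁ : ContinuousOn y₁ (Icc 0 b)) (hc₂ : ContinuousOn y₂ (Icc 0 b))
    (hac₁ : AbsolutelyContinuousOnInterval y₁ 0 b) (hac₂ : AbsolutelyContinuousOnInterval y₂ 0 b)
    (hd₁ : ∀ᵐ t, t ∈ Ioo 0 b →
      HasDerivAt y₁ (p' * ((c - h t) * (max (y₁ t) 0) ^ (1 / p) - f t)) t)
    (hd₂ : ∀ᵐ t, t ∈ Ioo 0 b →
      HasDerivAt y₂ (p' * ((c - h t) * (max (y₂ t) 0) ^ (1 / p) - f t)) t)
    (h₁0 : y₁ 0 = 0) (h₂0 : y₂ 0 = 0)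
    (hpos₁ : ∀ t ∈ Ioc 0 b, 0 < y₁ t) (hpos₂ : ∀ t ∈ Ioc 0 b, 0 < y₂ t) : y₁ b = y₂ b := by
  have hr : 0 < 1 / p := by positivity
  have hq : 0 < 1 - 1 / p := by
    rw [sub_pos, div_lt_one (by linarith)]
    exact hp
  set q := 1 - 1 / p with hqdef
  set V : ℝ → ℝ := fun t => (y₁ t ^ q - y₂ t ^ q) * (y₁ t ^ q - y₂ t ^ q) with hV
  have hle : ∀ ε ∈ Ioo 0 b, V b ≤ V ε := by
    intro ε hε
    have hsub : uIcc ε b ⊆ uIcc 0 b := by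
      rw [uIcc_of_le hε.2.le, uIcc_of_le hb.le]
      exact Icc_subset_Icc_left hε.1.le
    have hac : ∀ y : ℝ → ℝ, AbsolutelyContinuousOnInterval y 0 b → (∀ t ∈ Ioc 0 b, 0 < y t) →
        AbsolutelyContinuousOnInterval (fun t => y t ^ q) ε b := by
      intro y hy hpos
      refine AbsolutelyContinuousOnInterval.contDiffOn_comp (φ := fun x => x ^ q) ?_ (hy.mono hsub)
      rintro _ ⟨t, ht, rfl⟩
      rw [uIcc_of_le hε.2.le] at ht
      exact (Real.contDiffAt_rpow_const_of_ne
        (hpos t ⟨hε.1.trans_le ht.1, ht.2⟩).ne').contDiffWithinAt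
    have hw := (hac y₁ hac₁ hpos₁).sub (hac y₂ hac₂ hpos₂)
    refine (hw.mul hw).le_of_ae_hasDerivAt_nonpos hε.2.le
      (f' := fun t => 2 * (-f t) * ((y₁ t ^ q - y₂ t ^ q) *
        (y₁ t ^ (-(1 / p)) - y₂ t ^ (-(1 / p))))) ?_
    filter_upwards [hd₁, hd₂] with t ht₁ ht₂ ht
    have ht0 : t ∈ Ioo 0 b := ⟨hε.1.trans ht.1, ht.2⟩
    have hy₁ := hpos₁ t (Ioo_subset_Ioc_self ht0)
    have hy₂ := hpos₂ t (Ioo_subset_Ioc_self ht0)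
    have hd := ((ht₁ ht0).rpow_caraSol hp hp' hy₁).sub ((ht₂ ht0).rpow_caraSol hp hp' hy₂)
    refine ⟨?_, ?_⟩
    · convert! hd.mul hd using 1
      simp only [Pi.sub_apply, ← hqdef]
      ring
    · exact mul_nonpos_of_nonneg_of_nonpos (by linarith [hf t ht0])
        (Real.sub_rpow_mul_sub_rpow_neg_nonpos hy₁ hy₂ hq.le hr.le)
  have hcV : ContinuousOn V (Icc 0 b) := by
    have hw := (hc₁.rpow_const (p := q) fun _ _ => Or.inr hq.le).sub
      (hc₂.rpow_const (p := q) fun _ _ => Or.inr hq.le)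
    exact hw.mul hw
  have hV0 : V 0 = 0 := by simp [hV, h₁0, h₂0]
  have hlim : Tendsto V (𝓝[>] 0) (𝓝 (V 0)) :=
    ((hcV 0 (left_mem_Icc.2 hb.le)).mono_of_mem_nhdsWithin (Icc_mem_nhdsGT hb)).tendsto
  have hVb : V b ≤ 0 := by
    rw [← hV0]
    refine ge_of_tendsto hlim ?_
    filter_upwards [Ioo_mem_nhdsGT hb] with ε hε using hle ε hε
  have hVb' : y₁ b ^ q - y₂ b ^ q = 0 :=
    mul_self_eq_zero.1 (le_antisymm hVb (mul_self_nonneg _))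
  have hbb : b ∈ Ioc 0 b := right_mem_Ioc.2 hb
  exact (Real.rpow_left_inj (hpos₁ b hbb).le (hpos₂ b hbb).le hq.ne').1 (sub_eq_zero.1 hVb')

/-- Forward uniqueness for solutions that stay positive. -/
theorem IsCaraSol.eq_of_pos {p p' c a b M : ℝ} {h f y₁ y₂ : ℝ → ℝ} (hab : a ≤ b)
    (hbd : ∀ t ∈ Icc a b, |h t| ≤ M)
    (hac₁ : AbsolutelyContinuousOnInterval y₁ a b) (hac₂ : AbsolutelyContinuousOnInterval y₂ a b)
    (hd₁ : ∀ᵐ t, t ∈ Ioo a b →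
      HasDerivAt y₁ (p' * ((c - h t) * (max (y₁ t) 0) ^ (1 / p) - f t)) t)
    (hd₂ : ∀ᵐ t, t ∈ Ioo a b →
      HasDerivAt y₂ (p' * ((c - h t) * (max (y₂ t) 0) ^ (1 / p) - f t)) t)
    (heq : y₁ a = y₂ a)
    (hpos₁ : ∀ t ∈ Icc a b, 0 < y₁ t) (hpos₂ : ∀ t ∈ Icc a b, 0 < y₂ t) : y₁ b = y₂ b := by
  have hc₁ := hac₁.continuousOn
  have hc₂ := hac₂.continuousOn
  rw [uIcc_of_le hab] at hc₁ hc₂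
  obtain ⟨t₀, ht₀, hmin⟩ := isCompact_Icc.exists_isMinOn (nonempty_Icc.2 hab) (hc₁.inf hc₂)
  obtain ⟨t₁, ht₁, hmax⟩ := isCompact_Icc.exists_isMaxOn (nonempty_Icc.2 hab) (hc₁.sup hc₂)
  set m := min (y₁ t₀) (y₂ t₀)
  set N := max (y₁ t₁) (y₂ t₁)
  have hm : 0 < m := lt_min (hpos₁ _ ht₀) (hpos₂ _ ht₀)
  have hmem₁ : ∀ t ∈ Icc a b, y₁ t ∈ Icc m N := fun t ht =>
    ⟨(hmin ht).trans (min_le_left _ _), (le_max_left _ _).trans (hmax ht)⟩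
  have hmem₂ : ∀ t ∈ Icc a b, y₂ t ∈ Icc m N := fun t ht =>
    ⟨(hmin ht).trans (min_le_right _ _), (le_max_right _ _).trans (hmax ht)⟩
  obtain ⟨K, hK⟩ : ∃ K, LipschitzOnWith K (fun x : ℝ => x ^ (1 / p)) (Icc m N) :=
    ContDiffOn.exists_lipschitzOnWith (n := 1)
      (fun x hx => (Real.contDiffAt_rpow_const_of_ne (hm.trans_le hx.1).ne').contDiffWithinAt)
      (by decide) (convex_Icc _ _) isCompact_Icc
  set L : ℝ := |p'| * (|c| + M) * K
  have hD := hac₁.sub hac₂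
  have hexp : AbsolutelyContinuousOnInterval (fun t : ℝ => Real.exp (-(2 * L * t))) a b :=
    ContDiffOn.absolutelyContinuousOnInterval (by fun_prop)
  have hkey := ((hD.mul hD).mul hexp).le_of_ae_hasDerivAt_nonpos hab
      (f' := fun t => 2 * ((y₁ t - y₂ t) * (p' * (c - h t) * (y₁ t ^ (1 / p) - y₂ t ^ (1 / p))) -
        L * (y₁ t - y₂ t) ^ 2) * Real.exp (-(2 * L * t))) <| by
    filter_upwards [hd₁, hd₂] with t hdt₁ hdt₂ ht
    have htI := Ioo_subset_Icc_self ht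
    have hd := (hdt₁ ht).sub (hdt₂ ht)
    rw [max_eq_left (hpos₁ t htI).le, max_eq_left (hpos₂ t htI).le] at hd
    have hde : HasDerivAt (fun t : ℝ => Real.exp (-(2 * L * t)))
        (Real.exp (-(2 * L * t)) * (-(2 * L * 1))) t :=
      ((hasDerivAt_id t).const_mul (2 * L)).neg.exp
    refine ⟨?_, ?_⟩
    · convert! (hd.mul hd).mul hde using 1
      simp only [Pi.sub_apply, Pi.mul_apply]
      ring
    · refine mul_nonpos_of_nonpos_of_nonneg ?_ (Real.exp_pos _).le
      have hlip := hK.dist_le_mul _ (hmem₁ t htI) _ (hmem₂ t htI)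
      rw [Real.dist_eq, Real.dist_eq] at hlip
      have hch : |c - h t| ≤ |c| + M :=
        (abs_sub _ _).trans (add_le_add_right (hbd t htI) _)
      have hM : 0 ≤ |c| + M := (abs_nonneg _).trans hch
      have hbound : (y₁ t - y₂ t) * (p' * (c - h t) * (y₁ t ^ (1 / p) - y₂ t ^ (1 / p))) ≤
          L * (y₁ t - y₂ t) ^ 2 := by
        calc _ ≤ |(y₁ t - y₂ t) * (p' * (c - h t) * (y₁ t ^ (1 / p) - y₂ t ^ (1 / p)))| :=
              le_abs_self _
          _ = |y₁ t - y₂ t| * (|p'| * |c - h t| * |y₁ t ^ (1 / p) - y₂ t ^ (1 / p)|) := by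
              simp only [abs_mul]
          _ ≤ |y₁ t - y₂ t| * (|p'| * (|c| + M) * (K * |y₁ t - y₂ t|)) := by gcongr
          _ = L * |y₁ t - y₂ t| ^ 2 := by ring
          _ = _ := by rw [sq_abs]
      linarith
  simp only [Pi.mul_apply, Pi.sub_apply, heq, sub_self, zero_mul] at hkey
  have hsq := nonpos_of_mul_nonpos_left hkey (Real.exp_pos _)
  exact sub_eq_zero.1 (mul_self_eq_zero.1 (le_antisymm hsq (mul_self_nonneg _)))

theorem stmt_4
    (p p' s : ℝ) (h f : ℝ → ℝ)
    (hp : 1 < p) (hp'def : p' = p / (p - 1))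
    (hs : s ∈ Set.Ioo (0:ℝ) 1)
    (hmeas : Measurable h)
    (hbd : ∃ M : ℝ, ∀ t ∈ Set.Icc (0:ℝ) 1, |h t| ≤ M)
    (hfint : MeasureTheory.IntegrableOn f (Set.Ioo (0:ℝ) 1))
    (hf0 : f 0 = 0) (hfs : f s = 0) (hf1 : f 1 = 0)
    (hfneg : ∀ t ∈ Set.Ioo (0:ℝ) s, f t < 0)
    (hfpos : ∀ t ∈ Set.Ioo s (1:ℝ), 0 < f t)
    (husc : UpperSemicontinuousOn f (Set.Ioo (0:ℝ) s))
    (hlsc : LowerSemicontinuousOn f (Set.Ioo s (1:ℝ)))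
    (c tstar : ℝ) (htstar : tstar ∈ Set.Ioo s 1)
    (y₁ y₂ : ℝ → ℝ)
    (h₁ : IsCaraSol p p' h f c 0 tstar y₁) (h₂ : IsCaraSol p p' h f c 0 tstar y₂)
    (h₁0 : y₁ 0 = 0) (h₂0 : y₂ 0 = 0)
    (h₁pos : ∀ t ∈ Set.Ioo (0:ℝ) tstar, 0 < y₁ t)
    (h₂pos : ∀ t ∈ Set.Ioo (0:ℝ) tstar, 0 < y₂ t) :
    Set.EqOn y₁ y₂ (Set.Icc 0 tstar) := by
  obtain ⟨M, hM⟩ := hbd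
  obtain ⟨hst, ht1⟩ := htstar
  have hs0 : 0 < s := hs.1
  have ht0 : 0 < tstar := hs0.trans hst
  have hfi : IntervalIntegrable f volume 0 tstar :=
    ((intervalIntegrable_iff_integrableOn_Ioo_of_le zero_le_one).2 hfint).mono_set <| by
      rw [uIcc_of_le ht0.le, uIcc_of_le zero_le_one]
      exact Icc_subset_Icc_right ht1.le
  have hM' : ∀ t ∈ Icc 0 tstar, |h t| ≤ M := fun t ht => hM t ⟨ht.1, ht.2.trans ht1.le⟩
  have hi₁ := h₁.intervalIntegrable ht0.le (by linarith) hmeas hM' hfi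
  have hi₂ := h₂.intervalIntegrable ht0.le (by linarith) hmeas hM' hfi
  have hac₁ := h₁.absolutelyContinuousOnInterval ht0.le hi₁
  have hac₂ := h₂.absolutelyContinuousOnInterval ht0.le hi₂
  have hd₁ := h₁.ae_hasDerivAt ht0.le hi₁
  have hd₂ := h₂.ae_hasDerivAt ht0.le hi₂
  have hleft : ∀ b ∈ Ioc 0 s, y₁ b = y₂ b := by
    intro b hb
    have hbt : b < tstar := hb.2.trans_lt hst
    have hI : Icc 0 b ⊆ Icc 0 tstar := Icc_subset_Icc_right hbt.le
    have hu : uIcc 0 b ⊆ uIcc 0 tstar := by rwa [uIcc_of_le hb.1.le, uIcc_of_le ht0.le]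
    exact IsCaraSol.eq_of_nonpos hp hp'def hb.1
      (fun t ht => (hfneg t ⟨ht.1, ht.2.trans_le hb.2⟩).le)
      (h₁.1.mono hI) (h₂.1.mono hI) (hac₁.mono hu) (hac₂.mono hu)
      (hd₁.mono fun t ht hb' => ht ⟨hb'.1, hb'.2.trans hbt⟩)
      (hd₂.mono fun t ht hb' => ht ⟨hb'.1, hb'.2.trans hbt⟩) h₁0 h₂0
      (fun t ht => h₁pos t ⟨ht.1, ht.2.trans_lt hbt⟩)
      (fun t ht => h₂pos t ⟨ht.1, ht.2.trans_lt hbt⟩)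
  have hright : ∀ b ∈ Ico s tstar, y₁ b = y₂ b := by
    intro b hb
    have hu : uIcc s b ⊆ uIcc 0 tstar := by
      rw [uIcc_of_le hb.1, uIcc_of_le ht0.le]
      exact Icc_subset_Icc hs0.le hb.2.le
    exact IsCaraSol.eq_of_pos hb.1 (fun t ht => hM' t ⟨hs0.le.trans ht.1, ht.2.trans hb.2.le⟩)
      (hac₁.mono hu) (hac₂.mono hu)
      (hd₁.mono fun t ht hb' => ht ⟨hs0.trans hb'.1, hb'.2.trans hb.2⟩)
      (hd₂.mono fun t ht hb' => ht ⟨hs0.trans hb'.1, hb'.2.trans hb.2⟩)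
      (hleft s ⟨hs0, le_rfl⟩)
      (fun t ht => h₁pos t ⟨hs0.trans_le ht.1, ht.2.trans_lt hb.2⟩)
      (fun t ht => h₂pos t ⟨hs0.trans_le ht.1, ht.2.trans_lt hb.2⟩)
  have hIoo : EqOn y₁ y₂ (Ioo 0 tstar) := fun t ht =>
    (le_total t s).elim (fun hts => hleft t ⟨ht.1, hts⟩) fun hst' => hright t ⟨hst', ht.2⟩
  exact hIoo.of_subset_closure h₁.1 h₂.1 Ioo_subset_Icc_self (closure_Ioo ht0.ne).ge
end
end

section
/- Assume in addition that h is continuous at s_*. If, for some c ∈ ℝ, the boundary value problem on [0, s_*] admits a positive solution, then c ≤ h(s_*) and c < (1/s_*) ∫₀^{s_*} h(t) dt. -/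
open MeasureTheory Set Filter Topology intervalIntegral

noncomputable section

/-- Post-composition with a function Lipschitz on the image preserves absolute continuity. -/
theorem AbsolutelyContinuousOnInterval.lipschitzOnWith_comp_s7 {y φ : ℝ → ℝ} {a b : ℝ} {K : NNReal}
    (hφ : LipschitzOnWith K φ (y '' uIcc a b)) (hy : AbsolutelyContinuousOnInterval y a b) :
    AbsolutelyContinuousOnInterval (φ ∘ y) a b := by
  rw [absolutelyContinuousOnInterval_iff] at hy ⊢
  intro ε hε
  obtain ⟨δ, hδ, H⟩ := hy (ε / (K + 1)) (by positivity)
  refine ⟨δ, hδ, fun E hE hlt ↦ ?_⟩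
  have hE' := H E hE hlt
  rw [lt_div_iff₀ (by positivity)] at hE'
  refine lt_of_le_of_lt ?_ hE'
  rw [Finset.sum_mul]
  refine Finset.sum_le_sum fun i hi ↦ ?_
  have hmem := hE.1 i hi
  have := hφ.dist_le_mul _ (mem_image_of_mem y hmem.1) _ (mem_image_of_mem y hmem.2)
  simp only [Function.comp_apply]
  nlinarith [dist_nonneg (x := y (E.2 i).1) (y := y (E.2 i).2)]

/-- Fundamental theorem of calculus for a `C¹` function of an indefinite integral. -/
theorem integral_deriv_comp_mul_eq_sub {y g φ : ℝ → ℝ} {a b : ℝ} (hab : a ≤ b)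
    (hg : IntervalIntegrable g volume a b)
    (hy : ∀ t ∈ Icc a b, y t = y a + ∫ u in a..t, g u)
    (hφ : ∀ t ∈ Icc a b, ContDiffAt ℝ 1 φ (y t)) :
    ∫ t in a..b, deriv φ (y t) * g t = φ (y b) - φ (y a) := by
  let Y : ℝ → ℝ := fun t ↦ y a + ∫ u in a..t, g u
  have hYy : ∀ t ∈ Icc a b, Y t = y t := fun t ht ↦ (hy t ht).symm
  have hYac : AbsolutelyContinuousOnInterval Y a b := by
    have h1 : AbsolutelyContinuousOnInterval (fun _ : ℝ ↦ y a) a b :=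
      (contDiff_const.contDiffOn).absolutelyContinuousOnInterval
    exact h1.add (hg.absolutelyContinuousOnInterval_intervalIntegral (by simp))
  have hconv : Convex ℝ (Y '' uIcc a b) :=
    ((isPreconnected_uIcc.image Y hYac.continuousOn).ordConnected).convex
  have hcomp : IsCompact (Y '' uIcc a b) := isCompact_uIcc.image_of_continuousOn hYac.continuousOn
  have hφY : ContDiffOn ℝ 1 φ (Y '' uIcc a b) := by
    rintro _ ⟨t, ht, rfl⟩
    rw [uIcc_of_le hab] at ht
    rw [hYy t ht]
    exact (hφ t ht).contDiffWithinAt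
  obtain ⟨K, hK⟩ := hφY.exists_lipschitzOnWith (by decide) hconv hcomp
  have hcompac := AbsolutelyContinuousOnInterval.lipschitzOnWith_comp_s7 hK hYac
  have hFTC := hcompac.integral_deriv_eq_sub
  simp only [Function.comp_apply, hYy b (right_mem_Icc.2 hab), hYy a (left_mem_Icc.2 hab)] at hFTC
  rw [← hFTC]
  refine intervalIntegral.integral_congr_ae ?_
  filter_upwards [hg.ae_hasDerivAt_integral] with t ht htab
  have htab' := uIoc_subset_uIcc htab
  have hY' : HasDerivAt Y (g t) t := (ht htab' a (by simp)).const_add (y a)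
  rw [uIcc_of_le hab] at htab'
  have hφ' : HasDerivAt φ (deriv φ (y t)) (Y t) := by
    rw [hYy t htab']
    exact ((hφ t htab').differentiableAt (by decide)).hasDerivAt
  exact (hφ'.comp t hY').deriv.symm

/-- A continuous function on `[a, b]`, strictly increasing on `(a, b)`, satisfies `f a < f b`. -/
theorem StrictMonoOn.endpoints_lt {f : ℝ → ℝ} {a b : ℝ} (hf : StrictMonoOn f (Ioo a b))
    (hab : a < b) (hc : ContinuousOn f (Icc a b)) : f a < f b := by
  obtain ⟨u, hau, hub⟩ := exists_between hab
  obtain ⟨v, huv, hvb⟩ := exists_between hub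
  have hu : u ∈ Ioo a b := ⟨hau, hub⟩
  have hv : v ∈ Ioo a b := ⟨hau.trans huv, hvb⟩
  have hleft : f a ≤ f u := by
    refine ContinuousWithinAt.closure_le (s := Ioo a u) (f := f) (g := fun _ ↦ f u)
      (by rw [closure_Ioo hau.ne]; exact left_mem_Icc.2 hau.le)
      ((hc a (left_mem_Icc.2 hab.le)).mono
        (Ioo_subset_Icc_self.trans (Icc_subset_Icc_right hub.le)))
      continuousWithinAt_const fun t ht ↦ (hf ⟨ht.1, ht.2.trans hub⟩ hu ht.2).le
  have hright : f v ≤ f b := by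
    refine ContinuousWithinAt.closure_le (s := Ioo v b) (f := fun _ ↦ f v) (g := f)
      (by rw [closure_Ioo hvb.ne]; exact right_mem_Icc.2 hvb.le) continuousWithinAt_const
      ((hc b (right_mem_Icc.2 hab.le)).mono
        (Ioo_subset_Icc_self.trans (Icc_subset_Icc_left hv.1.le)))
      fun t ht ↦ (hf hv ⟨hv.1.trans ht.1, ht.2⟩ ht.1).le
  exact hleft.trans_lt ((hf hu hv huv).trans_le hright)

theorem stmt_7
    (p p' s : ℝ) (h f : ℝ → ℝ)
    (hp : 1 < p) (hp'def : p' = p / (p - 1))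
    (hs : s ∈ Set.Ioo (0:ℝ) 1)
    (hmeas : Measurable h)
    (hbd : ∃ M : ℝ, ∀ t ∈ Set.Icc (0:ℝ) 1, |h t| ≤ M)
    (hfint : MeasureTheory.IntegrableOn f (Set.Ioo (0:ℝ) 1))
    (hf0 : f 0 = 0) (hfs : f s = 0) (hf1 : f 1 = 0)
    (hfneg : ∀ t ∈ Set.Ioo (0:ℝ) s, f t < 0)
    (hfpos : ∀ t ∈ Set.Ioo s (1:ℝ), 0 < f t)
    (husc : UpperSemicontinuousOn f (Set.Ioo (0:ℝ) s))
    (hlsc : LowerSemicontinuousOn f (Set.Ioo s (1:ℝ)))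
    (hhc : ContinuousAt h s)
    (c : ℝ) (hsol : ∃ y, IsPosBVPSol p p' h f c 0 s y) :
    c ≤ h s ∧ c < (∫ t in (0:ℝ)..s, h t) / s := by
  obtain ⟨hs0, hs1⟩ := hs
  obtain ⟨M, hM⟩ := hbd
  obtain ⟨y, ⟨hyc, hyeq⟩, hy0, hys, hypos⟩ := hsol
  have hp0 : 0 < p := by linarith
  have hp'pos : 0 < p' := by rw [hp'def]; exact div_pos hp0 (by linarith)
  have hfI : IntervalIntegrable f volume 0 s := by
    rw [intervalIntegrable_iff_integrableOn_Ioo_of_le hs0.le]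
    exact hfint.mono_set (Ioo_subset_Ioo_right hs1.le)
  have hhI : IntervalIntegrable (fun t ↦ c - h t) volume 0 s := by
    refine intervalIntegrable_const.sub ?_
    rw [intervalIntegrable_iff_integrableOn_Ioc_of_le hs0.le]
    refine Measure.integrableOn_of_bounded (M := M) (by simp) hmeas.aestronglyMeasurable ?_
    filter_upwards [ae_restrict_mem measurableSet_Ioc] with t ht
    exact hM t ⟨ht.1.le, ht.2.trans hs1.le⟩
  have hrpow : ContinuousOn (fun t ↦ (max (y t) 0) ^ (1 / p)) (uIcc 0 s) := by
    rw [uIcc_of_le hs0.le]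
    exact (hyc.sup continuousOn_const).rpow_const fun t _ ↦ Or.inr (by positivity)
  set g : ℝ → ℝ := fun u ↦ p' * ((c - h u) * (max (y u) 0) ^ (1 / p) - f u) with hgdef
  have hgI : IntervalIntegrable g volume 0 s :=
    ((hhI.mul_continuousOn hrpow).sub hfI).const_mul p'
  have hsub : ∀ {a b}, 0 ≤ a → a ≤ b → b ≤ s → uIcc a b ⊆ uIcc 0 s := by
    intro a b ha hab hb
    rw [uIcc_of_le hab, uIcc_of_le hs0.le]
    exact Icc_subset_Icc ha hb
  have hyinc : ∀ {a t}, 0 ≤ a → a ≤ t → t ≤ s → y t = y a + ∫ u in a..t, g u := by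
    intro a t ha hat ht
    rw [hyeq t ⟨ha.trans hat, ht⟩, hyeq a ⟨ha, hat.trans ht⟩, add_assoc,
      integral_add_adjacent_intervals (hgI.mono_set (hsub le_rfl ha (hat.trans ht)))
        (hgI.mono_set (hsub ha hat ht))]
  constructor
  · by_contra! hlt
    obtain ⟨a, ha, hac⟩ := (mem_nhdsLT_iff_exists_mem_Ico_Ioo_subset hs0).1
      (mem_nhdsWithin_of_mem_nhds (hhc.eventually_lt_const hlt))
    obtain ⟨b, hab, hbs⟩ := exists_between ha.2
    have hb0 : 0 < b := ha.1.trans_lt hab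
    have hint : 0 ≤ ∫ u in b..s, g u := by
      rw [integral_of_le hbs.le, integral_Ioc_eq_integral_Ioo]
      refine setIntegral_nonneg measurableSet_Ioo fun u hu ↦ mul_nonneg hp'pos.le ?_
      have hcu : h u < c := hac ⟨hab.trans hu.1, hu.2⟩
      have hfu := hfneg u ⟨hb0.trans hu.1, hu.2⟩
      have := mul_nonneg (sub_nonneg.2 hcu.le)
        (Real.rpow_nonneg (le_max_right (y u) 0) (1 / p))
      linarith
    have := hyinc hb0.le hbs.le le_rfl
    linarith [hypos b ⟨hb0, hbs⟩]
  · let F : ℝ → ℝ := fun t ↦ (y t) ^ (1 - 1 / p) - ∫ u in (0:ℝ)..t, (c - h u)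
    have hq : 0 < 1 - 1 / p := by
      rw [sub_pos, div_lt_one hp0]; exact hp
    have hFc : ContinuousOn F (Icc 0 s) := by
      refine (hyc.rpow_const fun t _ ↦ Or.inr hq.le).sub ?_
      have := continuousOn_primitive_interval' hhI left_mem_uIcc
      rwa [uIcc_of_le hs0.le] at this
    have hFmono : StrictMonoOn F (Ioo 0 s) := by
      intro a ha b hb hab
      have hI := hsub ha.1.le hab.le hb.2.le
      have hpos : ∀ t ∈ Icc a b, 0 < y t :=
        fun t ht ↦ hypos t ⟨ha.1.trans_le ht.1, ht.2.trans_lt hb.2⟩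
      have hwI : IntervalIntegrable (fun t ↦ -f t * (y t) ^ (-(1 / p))) volume a b := by
        refine (hfI.mono_set hI).neg.mul_continuousOn ?_
        rw [uIcc_of_le hab.le]
        exact (hyc.mono (Icc_subset_Icc ha.1.le hb.2.le)).rpow_const
          fun t ht ↦ Or.inl (hpos t ht).ne'
      have hwpos : 0 < ∫ t in a..b, -f t * (y t) ^ (-(1 / p)) := by
        refine intervalIntegral_pos_of_pos_on hwI (fun t ht ↦ ?_) hab
        exact mul_pos (neg_pos.2 (hfneg t ⟨ha.1.trans ht.1, ht.2.trans hb.2⟩))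
          (Real.rpow_pos_of_pos (hpos t (Ioo_subset_Icc_self ht)) _)
      have hchain := integral_deriv_comp_mul_eq_sub (φ := fun x ↦ x ^ (1 - 1 / p)) hab.le
        (hgI.mono_set hI) (fun t ht ↦ hyinc ha.1.le ht.1 (ht.2.trans hb.2.le))
        (fun t ht ↦ Real.contDiffAt_rpow_const_of_ne (hpos t ht).ne')
      have hcongr : ∫ t in a..b, deriv (fun x : ℝ ↦ x ^ (1 - 1 / p)) (y t) * g t =
          ∫ t in a..b, ((c - h t) + -f t * (y t) ^ (-(1 / p))) := by
        refine integral_congr fun t ht ↦ ?_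
        rw [uIcc_of_le hab.le] at ht
        have hyt := hpos t ht
        have hone : (y t) ^ (-(1 / p)) * (y t) ^ (1 / p) = 1 := by
          rw [← Real.rpow_add hyt, neg_add_cancel, Real.rpow_zero]
        have hqp : (1 - 1 / p) * p' = 1 := by
          have : p - 1 ≠ 0 := by linarith
          rw [hp'def]; field_simp
        have hd : deriv (fun x : ℝ ↦ x ^ (1 - 1 / p)) (y t) = (1 - 1 / p) * y t ^ (-(1 / p)) := by
          rw [(Real.hasDerivAt_rpow_const (Or.inl hyt.ne')).deriv]
          ring_nf
        simp only [hd, hgdef, max_eq_left hyt.le]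
        linear_combination (y t ^ (-(1 / p)) * ((c - h t) * y t ^ (1 / p) - f t)) * hqp
          + (c - h t) * hone
      rw [hcongr, integral_add (hhI.mono_set hI) hwI] at hchain
      have hadj := integral_add_adjacent_intervals
        (hhI.mono_set (hsub le_rfl ha.1.le ha.2.le)) (hhI.mono_set hI)
      simp only [F]
      linarith
    have hlt : F 0 < F s := hFmono.endpoints_lt hs0 hFc
    have hne : 1 - 1 / p ≠ 0 := hq.ne'
    have hsplit : ∫ u in (0:ℝ)..s, (c - h u) = s * c - ∫ u in (0:ℝ)..s, h u := by
      have hh : IntervalIntegrable h volume 0 s := by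
        simpa using (intervalIntegrable_const (c := c)).sub hhI
      rw [integral_sub intervalIntegrable_const hh]
      simp
    simp only [F, hy0, hys, Real.zero_rpow hne, integral_same, hsplit] at hlt
    rw [lt_div_iff₀ hs0]
    linarith
end
end

section
/- Assume in addition that h is continuous at s_*. If, for some c ∈ ℝ, the boundary value problem on [s_*, 1] admits a positive solution, then c ≥ h(s_*) and c > (1/(1 − s_*)) ∫_{s_*}^1 h(t) dt. -/
open MeasureTheory Set Filter Topology intervalIntegral

noncomputable section

/-- Postcomposition with a Lipschitz function preserves absolute continuity. -/
theorem LipschitzOnWith.comp_absolutelyContinuousOnInterval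
    {φ F : ℝ → ℝ} {K : NNReal} {u : Set ℝ} {a b : ℝ}
    (hφ : LipschitzOnWith K φ u) (hF : AbsolutelyContinuousOnInterval F a b)
    (hmaps : MapsTo F (uIcc a b) u) :
    AbsolutelyContinuousOnInterval (fun t ↦ φ (F t)) a b := by
  rw [absolutelyContinuousOnInterval_iff] at hF ⊢
  intro ε hε
  obtain ⟨δ, hδ, H⟩ := hF (ε / (K + 1)) (by positivity)
  refine ⟨δ, hδ, fun E hE hlt ↦ ?_⟩
  have hsum := H E hE hlt
  calc
    _ ≤ ∑ i ∈ Finset.range E.1, (K : ℝ) * dist (F (E.2 i).1) (F (E.2 i).2) :=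
      Finset.sum_le_sum fun i hi ↦
        hφ.dist_le_mul _ (hmaps (hE.1 i hi).1) _ (hmaps (hE.1 i hi).2)
    _ = K * ∑ i ∈ Finset.range E.1, dist (F (E.2 i).1) (F (E.2 i).2) :=
      (Finset.mul_sum _ _ _).symm
    _ ≤ K * (ε / (K + 1)) := by gcongr
    _ < (K + 1) * (ε / (K + 1)) := by gcongr; linarith
    _ = ε := by field

/-- Real powers are absolutely continuous along positive absolutely continuous functions. -/
theorem AbsolutelyContinuousOnInterval.rpow_const_of_pos {F : ℝ → ℝ} {a b : ℝ}
    (hF : AbsolutelyContinuousOnInterval F a b) (hpos : ∀ t ∈ uIcc a b, 0 < F t) (α : ℝ) :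
    AbsolutelyContinuousOnInterval (fun t ↦ F t ^ α) a b := by
  obtain ⟨x, hx, hmin⟩ := isCompact_uIcc.exists_isMinOn nonempty_uIcc hF.continuousOn
  obtain ⟨z, -, hmax⟩ := isCompact_uIcc.exists_isMaxOn nonempty_uIcc hF.continuousOn
  have hdiff : ContDiffOn ℝ 1 (fun r : ℝ ↦ r ^ α) (Icc (F x) (F z)) := fun r hr ↦
    (Real.contDiffAt_rpow_const_of_ne ((hpos x hx).trans_le hr.1).ne').contDiffWithinAt
  obtain ⟨K, hK⟩ := hdiff.exists_lipschitzOnWith (by decide) (convex_Icc _ _) isCompact_Icc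
  exact hK.comp_absolutelyContinuousOnInterval hF fun t ht ↦ ⟨hmin ht, hmax ht⟩

/-- An absolutely continuous function with a.e. negative derivative decreases strictly. -/
theorem AbsolutelyContinuousOnInterval.lt_of_ae_deriv_eq_neg {F G : ℝ → ℝ} {a b : ℝ}
    (hab : a < b) (hF : AbsolutelyContinuousOnInterval F a b)
    (hderiv : ∀ᵐ t, t ∈ uIoc a b → deriv F t = -G t) (hG : ∀ t ∈ Ioo a b, 0 < G t) :
    F b < F a := by
  have hint : IntervalIntegrable (fun t ↦ -deriv F t) volume a b :=
    hF.intervalIntegrable_deriv.neg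
  have hneg : ∀ᵐ t, t ∈ uIoc a b → -deriv F t = G t := by
    filter_upwards [hderiv] with t ht hmem
    rw [ht hmem, neg_neg]
  have hGint : IntervalIntegrable G volume a b :=
    hint.congr_ae ((ae_restrict_iff' measurableSet_uIoc).2 hneg)
  have hpos := intervalIntegral_pos_of_pos_on hGint hG hab
  rw [← integral_congr_ae hneg, intervalIntegral.integral_neg, hF.integral_deriv_eq_sub] at hpos
  linarith

/-- Strict decrease on an open interval extends to the endpoints by continuity. -/
theorem StrictAntiOn.lt_of_continuousOn_Icc {F : ℝ → ℝ} {a b : ℝ} (hab : a < b)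
    (hF : StrictAntiOn F (Ioo a b)) (hcont : ContinuousOn F (Icc a b)) : F b < F a := by
  obtain ⟨u, hau, hub⟩ := exists_between hab
  obtain ⟨v, huv, hvb⟩ := exists_between hub
  have hleft : F u ≤ F a := by
    have hmem : a ∈ closure (Ioo a u) := by
      rw [closure_Ioo hau.ne]
      exact left_mem_Icc.2 hau.le
    exact ContinuousWithinAt.closure_le hmem continuousWithinAt_const
      ((hcont a (left_mem_Icc.2 hab.le)).mono fun t ht ↦ ⟨ht.1.le, (ht.2.trans hub).le⟩)
      fun t ht ↦ (hF ⟨ht.1, ht.2.trans hub⟩ ⟨hau, hub⟩ ht.2).le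
  have hright : F b ≤ F v := by
    have hmem : b ∈ closure (Ioo v b) := by
      rw [closure_Ioo hvb.ne]
      exact right_mem_Icc.2 hvb.le
    exact ContinuousWithinAt.closure_le hmem
      ((hcont b (right_mem_Icc.2 hab.le)).mono fun t ht ↦
        ⟨((hau.trans huv).trans ht.1).le, ht.2.le⟩)
      continuousWithinAt_const
      fun t ht ↦ (hF ⟨hau.trans huv, hvb⟩ ⟨(hau.trans huv).trans ht.1, ht.2⟩ ht.1).le
  exact hright.trans_lt ((hF ⟨hau, hub⟩ ⟨hau.trans huv, hvb⟩ huv).trans_le hleft)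

theorem stmt_8
    (p p' s : ℝ) (h f : ℝ → ℝ)
    (hp : 1 < p) (hp'def : p' = p / (p - 1))
    (hs : s ∈ Set.Ioo (0:ℝ) 1)
    (hmeas : Measurable h)
    (hbd : ∃ M : ℝ, ∀ t ∈ Set.Icc (0:ℝ) 1, |h t| ≤ M)
    (hfint : MeasureTheory.IntegrableOn f (Set.Ioo (0:ℝ) 1))
    (hf0 : f 0 = 0) (hfs : f s = 0) (hf1 : f 1 = 0)
    (hfneg : ∀ t ∈ Set.Ioo (0:ℝ) s, f t < 0)
    (hfpos : ∀ t ∈ Set.Ioo s (1:ℝ), 0 < f t)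
    (husc : UpperSemicontinuousOn f (Set.Ioo (0:ℝ) s))
    (hlsc : LowerSemicontinuousOn f (Set.Ioo s (1:ℝ)))
    (hhc : ContinuousAt h s)
    (c : ℝ) (hsol : ∃ y, IsPosBVPSol p p' h f c s 1 y) :
    h s ≤ c ∧ (∫ t in s..(1:ℝ), h t) / (1 - s) < c := by
  obtain ⟨y, ⟨hycont, hyeq⟩, hys, hy1, hypos⟩ := hsol
  obtain ⟨M, hM⟩ := hbd
  obtain ⟨hs0, hs1⟩ := hs
  have hp0 : 0 < p := by linarith
  have hp1 : 0 < p - 1 := by linarith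
  have hp'pos : 0 < p' := hp'def ▸ div_pos hp0 hp1
  set g : ℝ → ℝ := fun u ↦ p' * ((c - h u) * (max (y u) 0) ^ (1 / p) - f u) with hg
  have hYeq : ∀ t ∈ Icc s 1, y t = ∫ u in s..t, g u := fun t ht ↦ by
    rw [hyeq t ht, hys, zero_add]
  have hhint : IntervalIntegrable (fun u ↦ c - h u) volume s 1 := by
    refine intervalIntegrable_const.sub ?_
    rw [intervalIntegrable_iff_integrableOn_Ioc_of_le hs1.le]
    refine Measure.integrableOn_of_bounded (M := M) (by simp) hmeas.aestronglyMeasurable ?_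
    refine (ae_restrict_iff' measurableSet_Ioc).2 (ae_of_all _ fun t ht ↦ ?_)
    exact hM t ⟨(hs0.trans ht.1).le, ht.2⟩
  have hfint' : IntervalIntegrable f volume s 1 := by
    rw [intervalIntegrable_iff_integrableOn_Ioo_of_le hs1.le]
    exact hfint.mono_set (Ioo_subset_Ioo_left hs0.le)
  have hgint : IntervalIntegrable g volume s 1 := by
    refine ((hhint.mul_continuousOn ?_).sub hfint').const_mul p'
    rw [uIcc_of_le hs1.le]
    exact (ContinuousOn.sup hycont continuousOn_const).rpow_const fun _ _ ↦ Or.inr (by positivity)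
  constructor
  · by_contra! hc
    obtain ⟨δ, hδ, hball⟩ := Metric.eventually_nhds_iff.1 (hhc.eventually (lt_mem_nhds hc))
    have ht : s < min (s + δ) ((s + 1) / 2) := lt_min (by linarith) (by linarith)
    set t := min (s + δ) ((s + 1) / 2)
    have htδ : t ≤ s + δ := min_le_left _ _
    have ht1 : t < 1 := (min_le_right _ _).trans_lt (by linarith)
    have hint : IntervalIntegrable (fun u ↦ -g u) volume s t :=
      (hgint.mono_set (by
        rw [uIcc_of_le ht.le, uIcc_of_le hs1.le]; exact Icc_subset_Icc_right ht1.le)).neg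
    have hneg : ∀ u ∈ Ioo s t, 0 < -g u := fun u hu ↦ by
      have hcu : c < h u := hball (by
        rw [Real.dist_eq, abs_of_pos (by linarith [hu.1])]; linarith [hu.2])
      have hfu := hfpos u ⟨hu.1, hu.2.trans ht1⟩
      have hpow : 0 ≤ (max (y u) 0) ^ (1 / p) := Real.rpow_nonneg (le_max_right _ _) _
      have hprod := mul_nonneg (sub_nonneg.2 hcu.le) hpow
      have : 0 < p' * ((h u - c) * (max (y u) 0) ^ (1 / p) + f u) := by positivity
      simp only [hg]
      linarith
    have hpos := intervalIntegral_pos_of_pos_on hint hneg ht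
    rw [intervalIntegral.integral_neg, ← hYeq t ⟨ht.le, ht1.le⟩] at hpos
    linarith [hypos t ⟨ht, ht1⟩]
  · set α : ℝ := 1 / p' with hα
    have hα_pos : 0 < α := by positivity
    have hα_sub : α - 1 = -(1 / p) := by rw [hα, hp'def]; field
    set D : ℝ → ℝ := fun t ↦ (∫ u in s..t, g u) ^ α - ∫ u in s..t, (c - h u) with hD
    have hsmem : s ∈ uIcc s 1 := left_mem_uIcc
    have hgac := hgint.absolutelyContinuousOnInterval_intervalIntegral hsmem
    have hhac := hhint.absolutelyContinuousOnInterval_intervalIntegral hsmem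
    have hanti : StrictAntiOn D (Ioo s 1) := by
      intro a ha b hb hab
      have hsub : uIcc a b ⊆ Ioo s 1 := by
        rw [uIcc_of_le hab.le]
        exact fun t ht ↦ ⟨ha.1.trans_le ht.1, ht.2.trans_lt hb.2⟩
      have hsub' : uIcc a b ⊆ uIcc s 1 := by
        rw [uIcc_of_le hs1.le]
        exact hsub.trans Ioo_subset_Icc_self
      have hYpos : ∀ t ∈ uIcc a b, 0 < ∫ u in s..t, g u := fun t ht ↦ by
        rw [← hYeq t (Ioo_subset_Icc_self (hsub ht))]
        exact hypos t (hsub ht)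
      have hDac : AbsolutelyContinuousOnInterval D a b :=
        ((hgac.mono hsub').rpow_const_of_pos hYpos α).sub (hhac.mono hsub')
      refine hDac.lt_of_ae_deriv_eq_neg hab (G := fun t ↦ f t * y t ^ (-(1 / p))) ?_ ?_
      · filter_upwards [hgint.ae_hasDerivAt_integral, hhint.ae_hasDerivAt_integral]
          with t htg hth ht
        have htab := uIoc_subset_uIcc ht
        have hyt := hypos t (hsub htab)
        have hdY := htg (hsub' htab) s hsmem
        have hdH := hth (hsub' htab) s hsmem
        have hd := (hdY.rpow_const (p := α) (Or.inl (hYpos t htab).ne')).sub hdH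
        rw [← hYeq t (Ioo_subset_Icc_self (hsub htab)), hα_sub] at hd
        refine hd.deriv.trans ?_
        have hmul : y t ^ (1 / p) * y t ^ (-(1 / p)) = 1 := by
          rw [← Real.rpow_add hyt, add_neg_cancel, Real.rpow_zero]
        have hpα : p' * α = 1 := mul_one_div_cancel hp'pos.ne'
        simp only [hg, max_eq_left hyt.le]
        linear_combination (c - h t) * p' * α * hmul
          + (c - h t - f t * y t ^ (-(1 / p))) * hpα
      · intro t ht
        have htm : t ∈ Ioo s 1 := hsub (uIcc_of_le hab.le ▸ Ioo_subset_Icc_self ht)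
        exact mul_pos (hfpos t htm) (Real.rpow_pos_of_pos (hypos t htm) _)
    have hDcont : ContinuousOn D (Icc s 1) := by
      rw [← uIcc_of_le hs1.le]
      exact (hgac.continuousOn.rpow_const fun _ _ ↦ Or.inr hα_pos.le).sub hhac.continuousOn
    have hlt := hanti.lt_of_continuousOn_Icc hs1 hDcont
    have hhint' : IntervalIntegrable h volume s 1 := by
      simpa using (intervalIntegrable_const (c := c)).sub hhint
    simp only [hD, ← hYeq 1 (right_mem_Icc.2 hs1.le), hy1, integral_same,
      Real.zero_rpow hα_pos.ne'] at hlt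
    rw [integral_sub intervalIntegrable_const hhint', intervalIntegral.integral_const, smul_eq_mul] at hlt
    rw [div_lt_iff₀ (by linarith)]
    linarith
end
end
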